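/- arXiv:2208.00687 — 2 statements merged into one kernel-verified Lean document; each statement's English description precedes it below -/
import Mathlib

section
/- Let d ∈ ℕ, α ∈ (0, min(2,d)) and β ∈ (0, d-α). There exists a constant c ≥ 1 (depending only on d, α, β) such that for all x with 0 < |x| ≤ 1/2: if β > 2 then c^{-1}|x|^{2-α} ≤ V_β(x) - κ_β|x|^{-α} ≤ c|x|^{2-α}; if β = 2 then c^{-1}|x|^{2-α}log(1/|x|) ≤ V_β(x) - κ_β|x|^{-α} ≤ c|x|^{2-α}log(1/|x|); and if β ∈ (0,2) then c^{-1}|x|^{β-α} ≤ V_β(x) - κ_β|x|^{-α} ≤ c|x|^{β-α}. -/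
open MeasureTheory Real Set Filter RealInnerProductSpace

noncomputable section

/-- Euclidean space `ℝ^d`. -/
abbrev Ed (d : ℕ) := EuclideanSpace ℝ (Fin d)

/-- Modified Bessel function of the second kind `K_ν(r)`. -/
def besselK (ν r : ℝ) : ℝ :=
  (1 / 2) * (r / 2) ^ ν * ∫ u in Ioi (0 : ℝ), u ^ (-ν - 1) * Real.exp (-u - r ^ 2 / (4 * u))

/-- Relativistic `α`-stable heat kernel with mass parameter `m`:
`p^m(t,x,y) = (2π)^{-d} ∫ exp(-i⟨y-x,z⟩) exp(-t(|z|²+m^{2/α})^{α/2}) dz`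
(the integral is real, and equals the cosine integral below). -/
def relKernel (d : ℕ) (α m t : ℝ) (x y : Ed d) : ℝ :=
  (2 * π) ^ (-(d : ℝ)) *
    ∫ z : Ed d, Real.cos ⟪y - x, z⟫ * Real.exp (-t * (‖z‖ ^ 2 + m ^ (2 / α)) ^ (α / 2))

/-- Fractional (`α`-stable) heat kernel `p⁰(t,x,y)`. -/
def fracKernel (d : ℕ) (α t : ℝ) (x y : Ed d) : ℝ :=
  (2 * π) ^ (-(d : ℝ)) * ∫ z : Ed d, Real.cos ⟪y - x, z⟫ * Real.exp (-t * ‖z‖ ^ α)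

/-- The summands of the perturbation series. -/
def pertN (d : ℕ) (k : ℝ → Ed d → Ed d → ℝ) (q : Ed d → ℝ) : ℕ → ℝ → Ed d → Ed d → ℝ
  | 0 => k
  | n + 1 => fun t x y =>
      ∫ s in Ioo (0 : ℝ) t, ∫ z : Ed d, pertN d k q n s x z * q z * k (t - s) z y

/-- Schrödinger perturbation of a transition density `k` by a potential `q`. -/
def pert (d : ℕ) (k : ℝ → Ed d → Ed d → ℝ) (q : Ed d → ℝ) (t : ℝ) (x y : Ed d) : ℝ :=
  ∑' n : ℕ, pertN d k q n t x y

/-- Radial profile of the potential `V_β`. -/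
def VProf (d : ℕ) (α β r : ℝ) : ℝ :=
  2 ^ (α / 2) * Real.Gamma (((d : ℝ) - β) / 2) / Real.Gamma (((d : ℝ) - β - α) / 2) *
    (besselK ((β + α) / 2) r / besselK (β / 2) r) * r ^ (-(α / 2))

/-- The potential `V_β(x)`. -/
def Vbeta (d : ℕ) (α β : ℝ) (x : Ed d) : ℝ := VProf d α β ‖x‖

/-- The Hardy constant `κ_β` for the fractional Laplacian. -/
def kappa (d : ℕ) (α β : ℝ) : ℝ :=
  2 ^ α * Real.Gamma ((β + α) / 2) * Real.Gamma (((d : ℝ) - β) / 2) /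
    (Real.Gamma (β / 2) * Real.Gamma (((d : ℝ) - β - α) / 2))

/-- `h^m_β(x) = ∫_0^∞ t^{(d-α-β)/α} p^m(t,x,0) dt`. -/
def hBetaM (d : ℕ) (α m β : ℝ) (x : Ed d) : ℝ :=
  ∫ t in Ioi (0 : ℝ), t ^ (((d : ℝ) - α - β) / α) * relKernel d α m t x 0

/-- `h_β = h^1_β`. -/
def hBeta (d : ℕ) (α β : ℝ) (x : Ed d) : ℝ := hBetaM d α 1 β x

/-- `V^m_β(x) = ((d-α-β)/α) h^m_{β+α}(x)/h^m_β(x)`. -/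
def VbetaM (d : ℕ) (α m β : ℝ) (x : Ed d) : ℝ :=
  (((d : ℝ) - α - β) / α) * hBetaM d α m (β + α) x / hBetaM d α m β x

/-- The function `H⁰(t,x)`. -/
def Hzero (d : ℕ) (α δ t : ℝ) (x : Ed d) : ℝ :=
  if δ ≤ ((d : ℝ) - α) / 2 then 1 + t ^ (δ / α) * ‖x‖ ^ (-δ)
  else 1 + t ^ (((d : ℝ) - α - δ) / α) * ‖x‖ ^ (-((d : ℝ) - α - δ))

/-- Density of the Lévy measure of the relativistic `α`-stable operator (mass 1). -/
def levyNu (d : ℕ) (α : ℝ) (x : Ed d) : ℝ :=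
  2 ^ ((α - (d : ℝ)) / 2 + 1) * π ^ (-(d : ℝ) / 2) * |Real.Gamma (-α / 2)|⁻¹ *
    besselK (((d : ℝ) + α) / 2) ‖x‖ / ‖x‖ ^ (((d : ℝ) + α) / 2)


def GB (ν s : ℝ) : ℝ := ∫ u in Ioi (0 : ℝ), Real.exp (-u) * u ^ (ν - 1) * Real.exp (-s / u)

lemma besselK_eq_GB (ν r : ℝ) (hr : 0 < r) :
    besselK ν r = (1 / 2) * (r / 2) ^ (-ν) * GB ν (r ^ 2 / 4) := by
  unfold besselK GB
  set s := r ^ 2 / 4 with hs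
  have hs0 : 0 < s := by positivity
  have h1 := integral_comp_mul_left_Ioi
    (fun u : ℝ => u ^ (-ν - 1) * Real.exp (-u - r ^ 2 / (4 * u))) 0 hs0
  have h2 := integral_comp_rpow_Ioi
    (fun u : ℝ => (s * u) ^ (-ν - 1) * Real.exp (-(s * u) - r ^ 2 / (4 * (s * u))))
    (p := -1) (by norm_num)
  rw [mul_zero] at h1
  have h3 : ∫ u in Ioi (0 : ℝ), u ^ (-ν - 1) * Real.exp (-u - r ^ 2 / (4 * u)) =
      s ^ (-ν) * ∫ u in Ioi (0 : ℝ), Real.exp (-u) * u ^ (ν - 1) * Real.exp (-s / u) := by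
    have h4 : ∫ u in Ioi (0 : ℝ), u ^ (-ν - 1) * Real.exp (-u - r ^ 2 / (4 * u)) =
      s * (s⁻¹ • ∫ u in Ioi (0 : ℝ), u ^ (-ν - 1) * Real.exp (-u - r ^ 2 / (4 * u))) := by
      rw [smul_eq_mul, mul_inv_cancel_left₀ hs0.ne']
    rw [h4, ← h1, ← h2, ← integral_const_mul, ← integral_const_mul]
    refine setIntegral_congr_fun measurableSet_Ioi fun x hx => ?_
    have hx0 : (0 : ℝ) < x := hx
    have hr2 : r ^ 2 = 4 * s := by rw [hs]; ring
    simp only [smul_eq_mul, hr2]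
    rw [show x ^ (-1 : ℝ) = x⁻¹ from Real.rpow_neg_one x]
    rw [Real.mul_rpow hs0.le (by positivity), Real.inv_rpow hx0.le, ← Real.rpow_neg hx0.le]
    have e1 : -(s * x⁻¹) - 4 * s / (4 * (s * x⁻¹)) = -x + -s / x := by
      field_simp; ring
    rw [e1, Real.exp_add]
    have e2 : x ^ (-1 - 1 : ℝ) * x ^ (-(-ν - 1)) = x ^ (ν - 1) := by
      rw [← Real.rpow_add hx0]; congr 1; ring
    have e3 : s * s ^ (-ν - 1) = s ^ (-ν) := by
      rw [Real.rpow_sub_one hs0.ne']; field_simp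
    rw [← e2, ← e3]
    norm_num
    ring
  rw [h3, hs]
  have e4 : (r / 2) ^ ν * (r ^ 2 / 4) ^ (-ν) = (r / 2) ^ (-ν) := by
    have : r ^ 2 / 4 = (r / 2) ^ (2 : ℝ) := by
      rw [Real.rpow_two]; ring
    rw [this, ← Real.rpow_mul (by positivity), ← Real.rpow_add (by positivity)]
    congr 1; ring
  rw [← e4]; ring

lemma gint (ν : ℝ) (hν : 0 < ν) :
    IntegrableOn (fun u : ℝ => Real.exp (-u) * u ^ (ν - 1)) (Ioi 0) :=
  Real.GammaIntegral_convergent hν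

lemma meas_e (s : ℝ) : Measurable (fun u : ℝ => Real.exp (-s / u)) := by fun_prop

lemma Gint (ν s : ℝ) (hν : 0 < ν) (hs : 0 ≤ s) :
    IntegrableOn (fun u : ℝ => Real.exp (-u) * u ^ (ν - 1) * Real.exp (-s / u)) (Ioi 0) := by
  refine Integrable.mono' (gint ν hν) ?_ ?_
  · exact (gint ν hν).aestronglyMeasurable.mul (meas_e s).aestronglyMeasurable
  · refine (ae_restrict_mem measurableSet_Ioi).mono fun x hx => ?_
    have hx0 : (0 : ℝ) < x := hx
    rw [Real.norm_of_nonneg (by positivity)]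
    refine mul_le_of_le_one_right (by positivity) (Real.exp_le_one_iff.2 ?_)
    rw [neg_div]; have : 0 ≤ s / x := by positivity
    linarith

lemma GB_le (ν s : ℝ) (hν : 0 < ν) (hs : 0 ≤ s) : GB ν s ≤ Real.Gamma ν := by
  rw [Real.Gamma_eq_integral hν]
  refine setIntegral_mono_on (Gint ν s hν hs) (gint ν hν) measurableSet_Ioi fun x hx => ?_
  have hx0 : (0 : ℝ) < x := hx
  refine mul_le_of_le_one_right (by positivity) (Real.exp_le_one_iff.2 ?_)
  rw [neg_div]; have : 0 ≤ s / x := by positivity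
  linarith

lemma GB_anti (ν s t : ℝ) (hν : 0 < ν) (hs : 0 ≤ s) (hst : s ≤ t) : GB ν t ≤ GB ν s := by
  refine setIntegral_mono_on (Gint ν t hν (hs.trans hst)) (Gint ν s hν hs) measurableSet_Ioi
    fun x hx => ?_
  have hx0 : (0 : ℝ) < x := hx
  refine mul_le_mul_of_nonneg_left (Real.exp_le_exp.2 ?_) (by positivity)
  rw [neg_div, neg_div]
  have : s / x ≤ t / x := by gcongr
  linarith

lemma GB_pos (ν s : ℝ) (hν : 0 < ν) (hs : 0 ≤ s) : 0 < GB ν s := by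
  unfold GB
  rw [setIntegral_pos_iff_support_of_nonneg_ae]
  · have : Ioi (0 : ℝ) ⊆ (Function.support fun u : ℝ =>
        Real.exp (-u) * u ^ (ν - 1) * Real.exp (-s / u)) ∩ Ioi 0 := by
      intro x hx
      have hx0 : (0 : ℝ) < x := hx
      refine ⟨?_, hx⟩
      rw [Function.mem_support]; positivity
    refine lt_of_lt_of_le ?_ (measure_mono this)
    simp
  · refine (ae_restrict_mem measurableSet_Ioi).mono fun x hx => ?_
    have hx0 : (0 : ℝ) < x := hx
    simp only [Pi.zero_apply]; positivity
  · exact Gint ν s hν hs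

/-- the deficit -/
lemma deficit_eq (ν s : ℝ) (hν : 0 < ν) (hs : 0 ≤ s) :
    Real.Gamma ν - GB ν s =
      ∫ u in Ioi (0 : ℝ), Real.exp (-u) * u ^ (ν - 1) * (1 - Real.exp (-s / u)) := by
  rw [Real.Gamma_eq_integral hν, GB, ← integral_sub (gint ν hν) (Gint ν s hν hs)]
  congr 1; ext x; ring

lemma deficit_int (ν s : ℝ) (hν : 0 < ν) (hs : 0 ≤ s) :
    IntegrableOn (fun u : ℝ => Real.exp (-u) * u ^ (ν - 1) * (1 - Real.exp (-s / u))) (Ioi 0) := by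
  refine ((gint ν hν).sub (Gint ν s hν hs)).congr ?_
  refine Eventually.of_forall fun x => ?_
  simp only [Pi.sub_apply]; ring

lemma upper_red (ν a : ℝ) (hν : 0 < ν) (ha : 0 < a) :
    ∃ C : ℝ, 0 < C ∧ ∀ s : ℝ, 0 < s → s ≤ 1 / 16 →
      GB (ν + a) s / GB ν s - Real.Gamma (ν + a) / Real.Gamma ν ≤
        C * (Real.Gamma ν - GB ν s) := by
  have hG := Real.Gamma_pos_of_pos hν
  have hGa := Real.Gamma_pos_of_pos (add_pos hν ha)
  have h16 := GB_pos ν (1 / 16) hν (by norm_num)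
  refine ⟨Real.Gamma (ν + a) / (GB ν (1 / 16) * Real.Gamma ν), by positivity, fun s hs hs1 => ?_⟩
  have hg := GB_pos ν s hν hs.le
  have h1 := GB_le (ν + a) s (add_pos hν ha) hs.le
  have h2 := GB_le ν s hν hs.le
  have h3 := GB_anti ν s (1 / 16) hν hs.le hs1
  calc GB (ν + a) s / GB ν s - Real.Gamma (ν + a) / Real.Gamma ν
      ≤ Real.Gamma (ν + a) / GB ν s - Real.Gamma (ν + a) / Real.Gamma ν := by gcongr
    _ = Real.Gamma (ν + a) / (GB ν s * Real.Gamma ν) * (Real.Gamma ν - GB ν s) := by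
        field_simp
    _ ≤ _ := by
        refine mul_le_mul_of_nonneg_right ?_ (by linarith)
        gcongr

lemma one_sub_exp_le (s u : ℝ) : 1 - Real.exp (-s / u) ≤ s / u := by
  have := Real.add_one_le_exp (-s / u)
  rw [neg_div] at *
  linarith

lemma def_upper_gt (ν : ℝ) (hν : 1 < ν) (s : ℝ) (hs : 0 < s) :
    Real.Gamma ν - GB ν s ≤ Real.Gamma (ν - 1) * s := by
  rw [deficit_eq ν s (by linarith) hs.le, Real.Gamma_eq_integral (by linarith),
    ← integral_mul_const]
  refine setIntegral_mono_on (deficit_int ν s (by linarith) hs.le)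
    ((gint (ν - 1) (by linarith)).mul_const s) measurableSet_Ioi fun x hx => ?_
  have hx0 : (0 : ℝ) < x := hx
  calc _ ≤ Real.exp (-x) * x ^ (ν - 1) * (s / x) :=
        mul_le_mul_of_nonneg_left (one_sub_exp_le s x) (by positivity)
    _ = _ := by rw [Real.rpow_sub_one hx0.ne' (ν - 1)]; field_simp

lemma def_split (ν s : ℝ) (hν : 0 < ν) (hs : 0 < s) (hν1 : ν ≤ 1) :
    Real.Gamma ν - GB ν s ≤ s ^ ν / ν + 
      ∫ u in Ioi s, Real.exp (-u) * u ^ (ν - 1) * (1 - Real.exp (-s / u)) := by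
  have hd := deficit_int ν s hν hs.le
  rw [deficit_eq ν s hν hs.le, ← Ioc_union_Ioi_eq_Ioi hs.le,
    setIntegral_union Ioc_disjoint_Ioi_same measurableSet_Ioi
      (hd.mono_set Ioc_subset_Ioi_self) (hd.mono_set (Ioi_subset_Ioi hs.le))]
  refine add_le_add_left ?_ _
  have hi : ∫ u in Ioc 0 s, u ^ (ν - 1) = s ^ ν / ν := by
    rw [← intervalIntegral.integral_of_le hs.le, integral_rpow (Or.inl (by linarith))]
    simp [Real.zero_rpow hν.ne']
  rw [← hi]
  refine setIntegral_mono_on (hd.mono_set Ioc_subset_Ioi_self) ?_ measurableSet_Ioc fun x hx => ?_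
  · rw [← intervalIntegrable_iff_integrableOn_Ioc_of_le hs.le]
    exact intervalIntegral.intervalIntegrable_rpow' (by linarith)
  · have hx0 : (0 : ℝ) < x := hx.1
    have h1 : Real.exp (-x) ≤ 1 := Real.exp_le_one_iff.2 (by linarith)
    have h2 : 1 - Real.exp (-s / x) ≤ 1 := by linarith [Real.exp_pos (-s / x)]
    calc _ ≤ Real.exp (-x) * x ^ (ν - 1) * 1 := mul_le_mul_of_nonneg_left h2 (by positivity)
      _ ≤ 1 * x ^ (ν - 1) * 1 := by gcongr
      _ = _ := by ring

lemma def_upper_lt (ν : ℝ) (hν : 0 < ν) (hν1 : ν < 1) (s : ℝ) (hs : 0 < s) :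
    Real.Gamma ν - GB ν s ≤ (1 / ν + 1 / (1 - ν)) * s ^ ν := by
  have hd := (deficit_int ν s hν hs.le).mono_set (Ioi_subset_Ioi hs.le)
  refine (def_split ν s hν hs hν1.le).trans ?_
  have hi : ∫ u in Ioi s, s * u ^ (ν - 2) = s ^ ν / (1 - ν) := by
    rw [integral_const_mul, integral_Ioi_rpow_of_lt (by linarith) hs,
      show ν - 2 + 1 = ν - 1 by ring, Real.rpow_sub_one hs.ne']
    have : ν - 1 ≠ 0 := by linarith
    have : 1 - ν ≠ 0 := by linarith
    field_simp
    ring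
  have h : ∫ u in Ioi s, Real.exp (-u) * u ^ (ν - 1) * (1 - Real.exp (-s / u)) ≤
      ∫ u in Ioi s, s * u ^ (ν - 2) := by
    refine setIntegral_mono_on hd ((integrableOn_Ioi_rpow_of_lt (by linarith) hs).const_mul s)
      measurableSet_Ioi fun x hx => ?_
    have hx0 : (0 : ℝ) < x := hs.trans hx
    have h1 : Real.exp (-x) ≤ 1 := Real.exp_le_one_iff.2 (by linarith)
    calc _ ≤ Real.exp (-x) * x ^ (ν - 1) * (s / x) :=
          mul_le_mul_of_nonneg_left (one_sub_exp_le s x) (by positivity)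
      _ ≤ 1 * x ^ (ν - 1) * (s / x) := by gcongr
      _ = _ := by
        rw [show ν - 2 = ν - 1 - 1 by ring, Real.rpow_sub_one hx0.ne' (ν - 1)]; field_simp
  rw [hi] at h
  calc _ ≤ s ^ ν / ν + s ^ ν / (1 - ν) := by linarith
    _ = _ := by ring

lemma def_upper_eq (s : ℝ) (hs : 0 < s) (hs1 : s ≤ 1 / 16) :
    Real.Gamma 1 - GB 1 s ≤ 3 * (s * Real.log (1 / s)) := by
  have hd := (deficit_int 1 s one_pos hs.le).mono_set (Ioi_subset_Ioi hs.le)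
  refine (def_split 1 s one_pos hs le_rfl).trans ?_
  have hle : s ≤ 1 := by linarith
  rw [← Ioc_union_Ioi_eq_Ioi hle, setIntegral_union Ioc_disjoint_Ioi_same measurableSet_Ioi
      (hd.mono_set Ioc_subset_Ioi_self) (hd.mono_set (Ioi_subset_Ioi hle))]
  have h1 : ∫ u in Ioc s 1, Real.exp (-u) * u ^ ((1 : ℝ) - 1) * (1 - Real.exp (-s / u)) ≤
      s * Real.log (1 / s) := by
    have : ∫ u in Ioc s 1, s * u⁻¹ = s * Real.log (1 / s) := by
      rw [integral_const_mul, ← intervalIntegral.integral_of_le hle, integral_inv_of_pos hs one_pos]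
    rw [← this]
    refine setIntegral_mono_on (hd.mono_set Ioc_subset_Ioi_self) ?_ measurableSet_Ioc
      fun x hx => ?_
    · rw [← intervalIntegrable_iff_integrableOn_Ioc_of_le hle]
      refine (intervalIntegral.intervalIntegrable_inv (fun x hx => ?_) continuousOn_id).const_mul s
      rw [uIcc_of_le hle] at hx
      exact (hs.trans_le hx.1).ne'
    · have hx0 : (0 : ℝ) < x := hs.trans hx.1
      have h1 : Real.exp (-x) ≤ 1 := Real.exp_le_one_iff.2 (by linarith)
      calc _ ≤ Real.exp (-x) * x ^ ((1 : ℝ) - 1) * (s / x) :=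
            mul_le_mul_of_nonneg_left (one_sub_exp_le s x) (by positivity)
        _ ≤ 1 * x ^ ((1 : ℝ) - 1) * (s / x) := by gcongr
        _ = _ := by simp; ring
  have h2 : ∫ u in Ioi (1 : ℝ), Real.exp (-u) * u ^ ((1 : ℝ) - 1) * (1 - Real.exp (-s / u)) ≤ s := by
    have h3 : ∫ u in Ioi (1 : ℝ), s * Real.exp (-u) ≤ s := by
      rw [integral_const_mul, integral_exp_neg_Ioi]
      exact mul_le_of_le_one_right hs.le (Real.exp_le_one_iff.2 (by norm_num))
    refine le_trans ?_ h3
    refine setIntegral_mono_on (hd.mono_set (Ioi_subset_Ioi hle))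
      ((integrableOn_exp_neg_Ioi 1).const_mul s) measurableSet_Ioi fun x hx => ?_
    have hx1 : (1 : ℝ) < x := hx
    have hx0 : (0 : ℝ) < x := by linarith
    calc _ ≤ Real.exp (-x) * x ^ ((1 : ℝ) - 1) * (s / x) :=
            mul_le_mul_of_nonneg_left (one_sub_exp_le s x) (by positivity)
      _ ≤ Real.exp (-x) * x ^ ((1 : ℝ) - 1) * s := by
        gcongr; exact div_le_self hs.le hx1.le
      _ = _ := by simp; ring
  have h4 : 1 ≤ Real.log (1 / s) := by
    rw [Real.le_log_iff_exp_le (by positivity)]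
    have : (16 : ℝ) ≤ 1 / s := by rw [le_div_iff₀ hs]; linarith
    linarith [Real.exp_one_lt_d9]
  have h5 : s ≤ s * Real.log (1 / s) := le_mul_of_one_le_right hs.le h4
  simp only [Real.rpow_one, div_one]
  linarith

/-- Lower bound reduction. -/
lemma lower_red (ν a : ℝ) (hν : 0 < ν) (ha : 0 < a) :
    ∃ c δ : ℝ, 0 < c ∧ 0 < δ ∧ δ ≤ 1 ∧ ∀ s : ℝ, 0 < s → s ≤ 1 / 16 →
      c * ∫ u in Ioc 0 δ, u ^ (ν - 1) * (s / (2 * u + s)) ≤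
        GB (ν + a) s / GB ν s - Real.Gamma (ν + a) / Real.Gamma ν := by
  have hG := Real.Gamma_pos_of_pos hν
  have hνa := add_pos hν ha
  have hGa := Real.Gamma_pos_of_pos hνa
  obtain ⟨m, hm⟩ : ∃ m, m = Real.Gamma (ν + a) / Real.Gamma ν := ⟨_, rfl⟩
  have hm0 : 0 < m := by rw [hm]; positivity
  obtain ⟨u0, hu0⟩ : ∃ u0, u0 = m ^ (1 / a) := ⟨_, rfl⟩
  have hu0p : 0 < u0 := by rw [hu0]; positivity
  have hu0a : u0 ^ a = m := by
    rw [hu0, ← Real.rpow_mul hm0.le]; field_simp; simp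
  obtain ⟨δ, hδ⟩ : ∃ δ, δ = min u0 1 / 2 := ⟨_, rfl⟩
  have hδ0 : 0 < δ := by rw [hδ]; positivity
  have hδ1 : δ ≤ 1 := by rw [hδ]; linarith [min_le_right u0 1]
  have hδu : δ ≤ u0 / 2 := by rw [hδ]; linarith [min_le_left u0 1]
  have h2a : (1 / 2 : ℝ) ^ a < 1 := Real.rpow_lt_one (by norm_num) (by norm_num) ha
  obtain ⟨k, hk⟩ : ∃ k, k = Real.exp (-1) * (m * (1 - (1 / 2 : ℝ) ^ a)) * Real.exp (-1 / u0) :=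
    ⟨_, rfl⟩
  have hk0 : 0 < k := by
    rw [hk]; have : 0 < 1 - (1 / 2 : ℝ) ^ a := by linarith
    positivity
  refine ⟨k / Real.Gamma ν, δ, by positivity, hδ0, hδ1, fun s hs hs1 => ?_⟩
  have hg := GB_pos ν s hν hs.le
  have hgle := GB_le ν s hν hs.le
  -- the key integrand
  set F : ℝ → ℝ := fun u => Real.exp (-u) * u ^ (ν - 1) * (u ^ a - m) *
    (Real.exp (-s / u) - Real.exp (-s / u0)) with hF
  have hFeq : ∀ u ∈ Ioi (0 : ℝ), F u =
      (Real.exp (-u) * u ^ (ν + a - 1) * Real.exp (-s / u)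
        - m * (Real.exp (-u) * u ^ (ν - 1) * Real.exp (-s / u))) -
      Real.exp (-s / u0) * (Real.exp (-u) * u ^ (ν + a - 1) - m * (Real.exp (-u) * u ^ (ν - 1))) := by
    intro u hu
    have hu0 : (0 : ℝ) < u := hu
    rw [hF, show ν + a - 1 = (ν - 1) + a by ring, Real.rpow_add hu0]
    ring
  have i1 := Gint (ν + a) s hνa hs.le
  have i2 := (Gint ν s hν hs.le).const_mul m
  have i3 := gint (ν + a) hνa
  have i4 := (gint ν hν).const_mul m
  have hFint : IntegrableOn F (Ioi 0) := by
    refine IntegrableOn.congr_fun ?_ (fun u hu => (hFeq u hu).symm) measurableSet_Ioi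
    exact (i1.sub i2).sub ((i3.sub i4).const_mul _)
  have hFI : ∫ u in Ioi (0 : ℝ), F u = GB (ν + a) s - m * GB ν s := by
    have i12 : Integrable (fun u : ℝ => Real.exp (-u) * u ^ (ν + a - 1) * Real.exp (-s / u)
        - m * (Real.exp (-u) * u ^ (ν - 1) * Real.exp (-s / u))) (volume.restrict (Ioi 0)) :=
      i1.sub i2
    have i34 : Integrable (fun u : ℝ => Real.exp (-u) * u ^ (ν + a - 1)
        - m * (Real.exp (-u) * u ^ (ν - 1))) (volume.restrict (Ioi 0)) := i3.sub i4
    rw [setIntegral_congr_fun measurableSet_Ioi hFeq,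
      integral_sub i12 (i34.const_mul _), integral_sub i1 i2, integral_const_mul,
      integral_const_mul, integral_sub i3 i4, integral_const_mul, ← Real.Gamma_eq_integral hν,
      ← Real.Gamma_eq_integral hνa, hm]
    unfold GB
    field_simp
    ring
  have hFnn : ∀ u ∈ Ioi (0 : ℝ), 0 ≤ F u := by
    intro u hu
    have hup : (0 : ℝ) < u := hu
    rw [hF]
    simp only
    rw [mul_assoc]
    refine mul_nonneg (by positivity) ?_
    rcases le_total u u0 with h | h
    · refine mul_nonneg_of_nonpos_of_nonpos ?_ ?_
      · rw [← hu0a]; linarith [Real.rpow_le_rpow hup.le h ha.le]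
      · rw [sub_nonpos, Real.exp_le_exp, neg_div, neg_div, neg_le_neg_iff]
        gcongr
    · refine mul_nonneg ?_ ?_
      · rw [← hu0a]; linarith [Real.rpow_le_rpow hu0p.le h ha.le]
      · rw [sub_nonneg, Real.exp_le_exp, neg_div, neg_div, neg_le_neg_iff]
        gcongr
  have hlow : k * ∫ u in Ioc 0 δ, u ^ (ν - 1) * (s / (2 * u + s)) ≤
      GB (ν + a) s - m * GB ν s := by
    rw [← hFI, ← integral_const_mul]
    refine le_trans ?_ (setIntegral_mono_set hFint
      ((ae_restrict_mem measurableSet_Ioi).mono fun x hx => hFnn x hx)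
      (Ioc_subset_Ioi_self : Ioc 0 δ ⊆ Ioi 0).eventuallyLE)
    have hii : IntegrableOn (fun u : ℝ => u ^ (ν - 1)) (Ioc 0 δ) := by
      rw [← intervalIntegrable_iff_integrableOn_Ioc_of_le hδ0.le]
      exact intervalIntegral.intervalIntegrable_rpow' (by linarith)
    refine setIntegral_mono_on ?_ (hFint.mono_set Ioc_subset_Ioi_self) measurableSet_Ioc
      fun u hu => ?_
    · refine Integrable.const_mul ?_ k
      refine Integrable.mono' hii ?_ ?_
      · exact hii.aestronglyMeasurable.mul (by fun_prop : Measurable _).aestronglyMeasurable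
      · refine (ae_restrict_mem measurableSet_Ioc).mono fun x hx => ?_
        have hx0 : (0 : ℝ) < x := hx.1
        rw [Real.norm_of_nonneg (by positivity)]
        refine mul_le_of_le_one_right (by positivity) ?_
        rw [div_le_one (by positivity)]; linarith
    · have hup : (0 : ℝ) < u := hu.1
      have hu2 : u ≤ u0 / 2 := hu.2.trans hδu
      have b1 : Real.exp (-1) ≤ Real.exp (-u) := Real.exp_le_exp.2 (by linarith [hu.2])
      have b2 : m * (1 - (1 / 2 : ℝ) ^ a) ≤ m - u ^ a := by
        have : u ^ a ≤ (u0 * (1 / 2)) ^ a :=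
          Real.rpow_le_rpow hup.le (by linarith) ha.le
        rw [Real.mul_rpow hu0p.le (by norm_num), hu0a] at this
        linarith
      have b3 : Real.exp (-1 / u0) * (s / (2 * u + s)) ≤
          Real.exp (-s / u0) - Real.exp (-s / u) := by
        have c1 : Real.exp (-1 / u0) ≤ Real.exp (-s / u0) := by
          rw [Real.exp_le_exp]; gcongr; linarith
        have c2 : Real.exp (-s / u) ≤ Real.exp (-s / u0) * Real.exp (-(s / (2 * u))) := by
          rw [← Real.exp_add, Real.exp_le_exp]
          have : s / u0 ≤ s / (2 * u) := by gcongr; linarith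
          have e : s / u = s / (2 * u) + s / (2 * u) := by field_simp; ring
          rw [neg_div, neg_div]; linarith
        have c3 : s / (2 * u + s) ≤ 1 - Real.exp (-(s / (2 * u))) := by
          rw [Real.exp_neg]
          have d1 := Real.add_one_le_exp (s / (2 * u))
          have d2 : (Real.exp (s / (2 * u)))⁻¹ ≤ (s / (2 * u) + 1)⁻¹ := by gcongr
          have d3 : (s / (2 * u) + 1)⁻¹ = 1 - s / (2 * u + s) := by field_simp; ring
          linarith
        have c4 : 0 ≤ s / (2 * u + s) := by positivity
        calc _ ≤ Real.exp (-s / u0) * (1 - Real.exp (-(s / (2 * u)))) := by gcongr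
          _ ≤ _ := by linarith
      have hpos : 0 ≤ 1 - (1 / 2 : ℝ) ^ a := by linarith
      have hpos2 : 0 ≤ m - u ^ a := le_trans (by positivity) b2
      calc k * (u ^ (ν - 1) * (s / (2 * u + s)))
          = (Real.exp (-1) * u ^ (ν - 1) * (m * (1 - (1 / 2 : ℝ) ^ a))) *
            (Real.exp (-1 / u0) * (s / (2 * u + s))) := by rw [hk]; ring
        _ ≤ (Real.exp (-u) * u ^ (ν - 1) * (m - u ^ a)) *
            (Real.exp (-s / u0) - Real.exp (-s / u)) := by gcongr
        _ = F u := by rw [hF]; ring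
  have hI0 : 0 ≤ ∫ u in Ioc 0 δ, u ^ (ν - 1) * (s / (2 * u + s)) :=
    setIntegral_nonneg measurableSet_Ioc fun u hu => by
      have : 0 < u := hu.1
      positivity
  rw [← hm]
  calc _ = (k * ∫ u in Ioc 0 δ, u ^ (ν - 1) * (s / (2 * u + s))) / Real.Gamma ν := by ring
    _ ≤ (k * ∫ u in Ioc 0 δ, u ^ (ν - 1) * (s / (2 * u + s))) / GB ν s := by gcongr
    _ ≤ (GB (ν + a) s - m * GB ν s) / GB ν s := by gcongr
    _ = _ := by field_simp

lemma lint (ν δ s : ℝ) (hν : 0 < ν) (hδ : 0 < δ) (hs : 0 < s) :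
    IntegrableOn (fun u : ℝ => u ^ (ν - 1) * (s / (2 * u + s))) (Ioc 0 δ) := by
  have hii : IntegrableOn (fun u : ℝ => u ^ (ν - 1)) (Ioc 0 δ) := by
    rw [← intervalIntegrable_iff_integrableOn_Ioc_of_le hδ.le]
    exact intervalIntegral.intervalIntegrable_rpow' (by linarith)
  refine Integrable.mono' hii ?_ ?_
  · exact hii.aestronglyMeasurable.mul (by fun_prop : Measurable _).aestronglyMeasurable
  · refine (ae_restrict_mem measurableSet_Ioc).mono fun x hx => ?_
    have hx0 : (0 : ℝ) < x := hx.1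
    rw [Real.norm_of_nonneg (by positivity)]
    refine mul_le_of_le_one_right (by positivity) ?_
    rw [div_le_one (by positivity)]; linarith

lemma low_sub (ν δ η q s : ℝ) (hν : 0 < ν) (hη : 0 < η) (hηδ : η ≤ δ) (hs : 0 < s)
    (hq : ∀ u, 0 < u → u ≤ η → q ≤ s / (2 * u + s)) :
    q * (η ^ ν / ν) ≤ ∫ u in Ioc 0 δ, u ^ (ν - 1) * (s / (2 * u + s)) := by
  have hδ : 0 < δ := hη.trans_le hηδ
  have hii : IntegrableOn (fun u : ℝ => u ^ (ν - 1)) (Ioc 0 η) := by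
    rw [← intervalIntegrable_iff_integrableOn_Ioc_of_le hη.le]
    exact intervalIntegral.intervalIntegrable_rpow' (by linarith)
  have hi : ∫ u in Ioc 0 η, u ^ (ν - 1) = η ^ ν / ν := by
    rw [← intervalIntegral.integral_of_le hη.le, integral_rpow (Or.inl (by linarith))]
    simp [Real.zero_rpow hν.ne']
  have hl := lint ν δ s hν hδ hs
  have hsub : Ioc 0 η ⊆ Ioc 0 δ := Ioc_subset_Ioc_right hηδ
  rw [← hi, ← integral_const_mul]
  refine le_trans ?_ (setIntegral_mono_set hl
    ((ae_restrict_mem measurableSet_Ioc).mono fun x hx => ?_) hsub.eventuallyLE)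
  · refine setIntegral_mono_on (hii.const_mul q) (hl.mono_set hsub) measurableSet_Ioc
      fun u hu => ?_
    have hu0 : 0 < u := hu.1
    rw [mul_comm]
    exact mul_le_mul_of_nonneg_left (hq u hu.1 hu.2) (by positivity)
  · have hx0 : 0 < x := hx.1
    simp only [Pi.zero_apply]
    positivity

lemma low_log (δ s : ℝ) (hδ : 0 < δ) (hs : 0 < s) (hs1 : s ≤ 1) :
    1 / (2 + 1 / δ) * (s * Real.log (1 / s)) ≤
      ∫ u in Ioc 0 δ, u ^ ((1 : ℝ) - 1) * (s / (2 * u + s)) := by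
  have hl := lint 1 δ s one_pos hδ hs
  have hsub : Ioc (δ * s) δ ⊆ Ioc 0 δ := Ioc_subset_Ioc_left (by positivity)
  have hle : δ * s ≤ δ := mul_le_of_le_one_right hδ.le hs1
  have hds : 0 < δ * s := by positivity
  have hi : ∫ u in Ioc (δ * s) δ, (1 / (2 + 1 / δ) * s) * u⁻¹ =
      1 / (2 + 1 / δ) * (s * Real.log (1 / s)) := by
    rw [integral_const_mul, ← intervalIntegral.integral_of_le hle, integral_inv_of_pos hds hδ,
      mul_assoc]
    congr 3
    field_simp
  rw [← hi]
  refine le_trans ?_ (setIntegral_mono_set hl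
    ((ae_restrict_mem measurableSet_Ioc).mono fun x hx => ?_) hsub.eventuallyLE)
  · refine setIntegral_mono_on ?_ (hl.mono_set hsub) measurableSet_Ioc fun u hu => ?_
    · rw [← intervalIntegrable_iff_integrableOn_Ioc_of_le hle]
      refine (intervalIntegral.intervalIntegrable_inv (fun x hx => ?_) continuousOn_id).const_mul _
      rw [uIcc_of_le hle] at hx
      exact (hds.trans_le hx.1).ne'
    · have hu0 : 0 < u := hds.trans hu.1
      have h1 : s ≤ u / δ := by rw [le_div_iff₀ hδ]; linarith [hu.1]
      have : (1 / (2 + 1 / δ) * s) * u⁻¹ = s / (2 * u + u / δ) := by field_simp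
      rw [this]
      simp only [sub_self, Real.rpow_zero, one_mul]
      gcongr
  · have hx0 : 0 < x := hx.1
    simp only [Pi.zero_apply]
    positivity

lemma core (ν a : ℝ) (hν : 0 < ν) (ha : 0 < a) :
    ∃ c C : ℝ, 0 < c ∧ 0 < C ∧ ∀ s : ℝ, 0 < s → s ≤ 1 / 16 →
      (1 < ν →
        c * s ≤ GB (ν + a) s / GB ν s - Real.Gamma (ν + a) / Real.Gamma ν ∧
        GB (ν + a) s / GB ν s - Real.Gamma (ν + a) / Real.Gamma ν ≤ C * s) ∧
      (ν = 1 →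
        c * (s * Real.log (1 / s)) ≤ GB (ν + a) s / GB ν s - Real.Gamma (ν + a) / Real.Gamma ν ∧
        GB (ν + a) s / GB ν s - Real.Gamma (ν + a) / Real.Gamma ν ≤ C * (s * Real.log (1 / s))) ∧
      (ν < 1 →
        c * s ^ ν ≤ GB (ν + a) s / GB ν s - Real.Gamma (ν + a) / Real.Gamma ν ∧
        GB (ν + a) s / GB ν s - Real.Gamma (ν + a) / Real.Gamma ν ≤ C * s ^ ν) := by
  obtain ⟨C, hC, hU⟩ := upper_red ν a hν ha
  obtain ⟨c, δ, hc, hδ, hδ1, hL⟩ := lower_red ν a hν ha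
  rcases lt_trichotomy ν 1 with h | h | h
  · have h1 : 0 < 1 - ν := by linarith
    refine ⟨c * (1 / (2 * δ + 1) * (δ ^ ν / ν)), C * (1 / ν + 1 / (1 - ν)), by positivity,
      by positivity, fun s hs hs1 => ⟨fun h' => by linarith, fun h' => by linarith, fun _ => ⟨?_, ?_⟩⟩⟩
    · refine le_trans ?_ (hL s hs hs1)
      have := low_sub ν δ (δ * s) (1 / (2 * δ + 1)) s hν (by positivity)
        (mul_le_of_le_one_right hδ.le (by linarith)) hs (fun u hu hu2 => by
          rw [div_le_div_iff₀ (by positivity) (by positivity)]; nlinarith)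
      rw [Real.mul_rpow hδ.le hs.le] at this
      calc _ = c * (1 / (2 * δ + 1) * (δ ^ ν * s ^ ν / ν)) := by ring
        _ ≤ _ := by gcongr
    · refine (hU s hs hs1).trans ?_
      rw [mul_assoc]
      gcongr
      exact def_upper_lt ν hν h s hs
  · subst h
    refine ⟨c * (1 / (2 + 1 / δ)), C * 3, by positivity, by positivity,
      fun s hs hs1 => ⟨fun h' => by linarith, fun _ => ⟨?_, ?_⟩, fun h' => by linarith⟩⟩
    · refine le_trans ?_ (hL s hs hs1)
      rw [mul_assoc]
      gcongr
      exact low_log δ s hδ hs (by linarith)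
    · refine (hU s hs hs1).trans ?_
      rw [mul_assoc]
      gcongr
      exact def_upper_eq s hs hs1
  · have hGp := Real.Gamma_pos_of_pos (show 0 < ν - 1 by linarith)
    refine ⟨c * (1 / (2 * δ + 1) * (δ ^ ν / ν)), C * Real.Gamma (ν - 1), by positivity,
      by positivity, fun s hs hs1 => ⟨fun _ => ⟨?_, ?_⟩, fun h' => by linarith, fun h' => by linarith⟩⟩
    · refine le_trans ?_ (hL s hs hs1)
      have := low_sub ν δ δ (s / (2 * δ + 1)) s hν hδ le_rfl hs (fun u hu hu2 => by
          gcongr; linarith)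
      calc _ = c * (s / (2 * δ + 1) * (δ ^ ν / ν)) := by ring
        _ ≤ _ := by gcongr
    · refine (hU s hs hs1).trans ?_
      rw [mul_assoc]
      gcongr
      exact def_upper_gt ν h s hs

lemma V_eq (d : ℕ) (α β r : ℝ) (hα : 0 < α) (hβ : 0 < β) (hr : 0 < r) :
    VProf d α β r - kappa d α β * r ^ (-α) =
      2 ^ α * (Real.Gamma (((d : ℝ) - β) / 2) / Real.Gamma (((d : ℝ) - β - α) / 2)) *
      (r ^ (-α) * (GB (β / 2 + α / 2) (r ^ 2 / 4) / GB (β / 2) (r ^ 2 / 4) -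
        Real.Gamma (β / 2 + α / 2) / Real.Gamma (β / 2))) := by
  unfold VProf kappa
  rw [besselK_eq_GB _ _ hr, besselK_eq_GB _ _ hr, show (β + α) / 2 = β / 2 + α / 2 by ring]
  have hg := GB_pos (β / 2) (r ^ 2 / 4) (by positivity) (by positivity)
  have hr2 : 0 < r / 2 := by positivity
  have e1 : (r / 2) ^ (-(β / 2 + α / 2)) = (r / 2) ^ (-(β / 2)) * (r / 2) ^ (-(α / 2)) := by
    rw [← Real.rpow_add hr2]; congr 1; ring
  have e2 : (2 : ℝ) ^ (α / 2) * ((r / 2) ^ (-(α / 2)) * r ^ (-(α / 2))) = 2 ^ α * r ^ (-α) := by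
    rw [Real.div_rpow hr.le (by norm_num), Real.rpow_neg (by norm_num : (0 : ℝ) ≤ 2),
      show α = α / 2 + α / 2 by ring, neg_add, Real.rpow_add hr, Real.rpow_add (by norm_num : (0 : ℝ) < 2)]
    simp only [add_halves]
    field_simp
  have hp : 0 < (r / 2) ^ (-(β / 2)) := by positivity
  have e3 : 1 / 2 * (r / 2) ^ (-(β / 2 + α / 2)) * GB (β / 2 + α / 2) (r ^ 2 / 4) /
      (1 / 2 * (r / 2) ^ (-(β / 2)) * GB (β / 2) (r ^ 2 / 4)) =
      (r / 2) ^ (-(α / 2)) * (GB (β / 2 + α / 2) (r ^ 2 / 4) / GB (β / 2) (r ^ 2 / 4)) := by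
    rw [e1]; field_simp
  rw [e3, mul_sub, mul_sub]
  congr 1
  · linear_combination (Real.Gamma (((d : ℝ) - β) / 2) / Real.Gamma (((d : ℝ) - β - α) / 2)) *
      (GB (β / 2 + α / 2) (r ^ 2 / 4) / GB (β / 2) (r ^ 2 / 4)) * e2
  · rw [mul_comm (Real.Gamma (β / 2)), ← div_div]; ring

/-- Sharp small-`|x|` estimates of `V_β(x) - κ_β|x|^{-α}` (Lemma 2.11). -/
theorem stmt_11 (d : ℕ) (α β : ℝ) (hα : α ∈ Ioo 0 (min 2 (d : ℝ)))
    (hβ : β ∈ Ioo 0 ((d : ℝ) - α)) :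
    ∃ c : ℝ, 1 ≤ c ∧ ∀ x : Ed d, 0 < ‖x‖ → ‖x‖ ≤ 1 / 2 →
      (2 < β →
        c⁻¹ * ‖x‖ ^ (2 - α) ≤ Vbeta d α β x - kappa d α β * ‖x‖ ^ (-α) ∧
          Vbeta d α β x - kappa d α β * ‖x‖ ^ (-α) ≤ c * ‖x‖ ^ (2 - α)) ∧
      (β = 2 →
        c⁻¹ * (‖x‖ ^ (2 - α) * Real.log (1 / ‖x‖)) ≤
            Vbeta d α β x - kappa d α β * ‖x‖ ^ (-α) ∧
          Vbeta d α β x - kappa d α β * ‖x‖ ^ (-α) ≤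
            c * (‖x‖ ^ (2 - α) * Real.log (1 / ‖x‖))) ∧
      (β < 2 →
        c⁻¹ * ‖x‖ ^ (β - α) ≤ Vbeta d α β x - kappa d α β * ‖x‖ ^ (-α) ∧
          Vbeta d α β x - kappa d α β * ‖x‖ ^ (-α) ≤ c * ‖x‖ ^ (β - α)) := by

  obtain ⟨hα0, hα1⟩ := hα
  obtain ⟨hβ0, hβ1⟩ := hβ
  obtain ⟨c, C, hc, hC, H⟩ := core (β / 2) (α / 2) (by positivity) (by positivity)
  obtain ⟨A, hA⟩ : ∃ A, A = 2 ^ α * (Real.Gamma (((d : ℝ) - β) / 2) /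
    Real.Gamma (((d : ℝ) - β - α) / 2)) := ⟨_, rfl⟩
  have hA0 : 0 < A := by
    have h1 := Real.Gamma_pos_of_pos (show 0 < ((d : ℝ) - β) / 2 by linarith)
    have h2 := Real.Gamma_pos_of_pos (show 0 < ((d : ℝ) - β - α) / 2 by linarith)
    rw [hA]; positivity
  -- reduction to arbitrary positive constants
  obtain ⟨p, hp⟩ : ∃ p : ℝ, p = (1 / 4) ^ (β / 2) := ⟨_, rfl⟩
  have hp0 : 0 < p := by rw [hp]; positivity
  have fin : ∀ k K : ℝ, 0 < k → 0 < K → (∀ f T : ℝ, 0 ≤ f → k * f ≤ T ∧ T ≤ K * f →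
      (max 1 (max K k⁻¹))⁻¹ * f ≤ T ∧ T ≤ (max 1 (max K k⁻¹)) * f) := by
    intro k K hk hK f T hf ⟨h1, h2⟩
    constructor
    · refine le_trans (mul_le_mul_of_nonneg_right ?_ hf) h1
      exact inv_le_of_inv_le₀ hk ((le_max_right _ _).trans (le_max_right _ _))
    · exact h2.trans (mul_le_mul_of_nonneg_right ((le_max_left _ _).trans (le_max_right _ _)) hf)
  obtain ⟨k, hk⟩ : ∃ k : ℝ, k = A * c * min (1 / 4) p := ⟨_, rfl⟩
  obtain ⟨K, hK⟩ : ∃ K : ℝ, K = A * C * max 1 p := ⟨_, rfl⟩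
  have hk0 : 0 < k := by rw [hk]; positivity
  have hK0 : 0 < K := by rw [hK]; positivity
  have hkp : k ≤ A * c * p := by rw [hk]; gcongr; exact min_le_right _ _
  have hk4 : k ≤ A * c * (1 / 4) := by rw [hk]; gcongr; exact min_le_left _ _
  have hKp : A * C * p ≤ K := by rw [hK]; gcongr; exact le_max_right _ _
  have hK1 : A * C ≤ K := by rw [hK]; exact le_mul_of_one_le_right (by positivity) (le_max_left _ _)
  refine ⟨max 1 (max K k⁻¹), le_max_left _ _, fun x hx hx2 => ?_⟩
  unfold Vbeta
  generalize ‖x‖ = r at hx hx2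
  rw [V_eq d α β r hα0 hβ0 hx, ← hA]
  obtain ⟨H1, H2, H3⟩ := H (r ^ 2 / 4) (by positivity) (by nlinarith)
  generalize GB (β / 2 + α / 2) (r ^ 2 / 4) / GB (β / 2) (r ^ 2 / 4) -
        Real.Gamma (β / 2 + α / 2) / Real.Gamma (β / 2) = T at H1 H2 H3
  have e2 : r ^ (2 - α) = r ^ (-α) * r ^ 2 := by
    rw [← Real.rpow_two, ← Real.rpow_add hx]; congr 1; ring
  have eb : r ^ (β - α) = r ^ (-α) * r ^ β := by
    rw [← Real.rpow_add hx]; congr 1; ring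
  have es : (r ^ 2 / 4) ^ (β / 2) = p * r ^ β := by
    rw [hp, div_eq_mul_one_div, Real.mul_rpow (by positivity) (by norm_num), ← Real.rpow_two,
      ← Real.rpow_mul hx.le, mul_comm]
    congr 2; ring
  have hR : 0 < r ^ (-α) := by positivity
  have hrb : 0 < r ^ β := by positivity
  have hl2 : Real.log 2 ≤ Real.log (1 / r) := by
    apply Real.log_le_log (by norm_num)
    rw [le_div_iff₀ hx]; linarith
  have hl0 : 0 < Real.log 2 := Real.log_pos (by norm_num)
  have hlog : Real.log (1 / (r ^ 2 / 4)) = 2 * Real.log 2 + 2 * Real.log (1 / r) := by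
    rw [show 1 / (r ^ 2 / 4) = 2 ^ 2 * (1 / r) ^ 2 by field_simp; norm_num,
      Real.log_mul (by norm_num) (by positivity), Real.log_pow, Real.log_pow]
    norm_num
  have key : ∀ f g : ℝ, 0 ≤ f → k * f ≤ A * c * g → A * C * g ≤ K * f → c * g ≤ T ∧ T ≤ C * g →
      k * (r ^ (-α) * f) ≤ A * (r ^ (-α) * T) ∧ A * (r ^ (-α) * T) ≤ K * (r ^ (-α) * f) := by
    intro f g hf h1 h2 ⟨h3, h4⟩
    constructor
    · calc _ = r ^ (-α) * (k * f) := by ring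
        _ ≤ r ^ (-α) * (A * c * g) := by gcongr
        _ = A * (r ^ (-α) * (c * g)) := by ring
        _ ≤ _ := by gcongr
    · calc _ ≤ A * (r ^ (-α) * (C * g)) := by gcongr
        _ = r ^ (-α) * (A * C * g) := by ring
        _ ≤ r ^ (-α) * (K * f) := by gcongr
        _ = _ := by ring
  have hr2 : 0 < r ^ 2 := by positivity
  have hAC : 0 < A * C := by positivity
  refine ⟨fun h => ?_, fun h => ?_, fun h => ?_⟩
  · refine fin k K hk0 hK0 _ _ (by positivity) ?_
    rw [e2]
    refine key _ _ hr2.le ?_ ?_ (H1 (by linarith))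
    · nlinarith
    · nlinarith
  · have hL : 0 < Real.log (1 / r) := by linarith
    refine fin k K hk0 hK0 _ _ (by positivity) ?_
    rw [e2, mul_assoc]
    refine key _ _ (by positivity) ?_ ?_ (H2 (by linarith))
    · rw [hlog]
      calc _ ≤ A * c * (1 / 4) * (r ^ 2 * Real.log (1 / r)) := by gcongr
        _ = A * c * (r ^ 2 / 4 * Real.log (1 / r)) := by ring
        _ ≤ _ := by gcongr; linarith
    · rw [hlog]
      calc _ ≤ A * C * (r ^ 2 / 4 * (4 * Real.log (1 / r))) := by gcongr; linarith
        _ = A * C * (r ^ 2 * Real.log (1 / r)) := by ring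
        _ ≤ _ := by gcongr
  · refine fin k K hk0 hK0 _ _ (by positivity) ?_
    rw [eb]
    refine key _ _ hrb.le ?_ ?_ (H3 (by linarith))
    · rw [es, ← mul_assoc]; gcongr
    · rw [es, ← mul_assoc]; gcongr
end
end

section
/- Let d ∈ ℕ, α ∈ (0, min(2,d)), β ∈ (0, d) and γ ∈ [β-α, ∞). There is a constant c > 0 such that for all t > 0 and x ∈ ℝ^d: if γ > β-α then ∫_0^t ∫_{ℝ^d} s^{γ/α} p⁰(s,x,z) |z|^{-β} dz ds ≤ c t^{(γ+α)/α} min(t^{-β/α}, |x|^{-β}), and if γ = β-α then ∫_0^t ∫_{ℝ^d} s^{γ/α} p⁰(s,x,z) |z|^{-β} dz ds ≤ c log(1 + t^{β/α}|x|^{-β}). -/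
open MeasureTheory Real Set Filter RealInnerProductSpace

noncomputable section

lemma L_meas {Ω : Type*} [MeasurableSpace Ω] (q : Ω → ℝ) (hq : Measurable q)
    (ν : Measure ℝ) [SFinite ν] (ρ : ℝ → ℝ) (hρm : Measurable ρ) :
    Measurable (fun ω => ∫ y, ρ y * Real.exp (-(y * q ω)) ∂ν) := by
  have : StronglyMeasurable (Function.uncurry fun (ω : Ω) (y : ℝ) => ρ y * Real.exp (-(y * q ω))) := by
    apply Measurable.stronglyMeasurable
    simp only [Function.uncurry_def]
    fun_prop
  exact this.integral_prod_right.measurable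

lemma L_nonneg {Ω : Type*} (q : Ω → ℝ)
    (ν : Measure ℝ) (ρ : ℝ → ℝ) (hρ0 : ∀ᵐ y ∂ν, 0 ≤ ρ y) (ω : Ω) :
    0 ≤ ∫ y, ρ y * Real.exp (-(y * q ω)) ∂ν := by
  apply integral_nonneg_of_ae
  filter_upwards [hρ0] with y hy
  simp only [Pi.zero_apply]; positivity

lemma L_le {Ω : Type*} (q : Ω → ℝ) (hq0 : ∀ ω, 0 ≤ q ω)
    (ν : Measure ℝ) (ρ : ℝ → ℝ) (hρ : Integrable ρ ν) (hρ0 : ∀ᵐ y ∂ν, 0 ≤ ρ y)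
    (hν : ∀ᵐ y ∂ν, 0 ≤ y) (ω : Ω) :
    ∫ y, ρ y * Real.exp (-(y * q ω)) ∂ν ≤ ∫ y, ρ y ∂ν := by
  apply integral_mono_of_nonneg _ hρ
  · filter_upwards [hρ0, hν] with y hy hy0
    have : Real.exp (-(y * q ω)) ≤ 1 := by
      rw [Real.exp_le_one_iff]; have := mul_nonneg hy0 (hq0 ω); linarith
    nlinarith
  · filter_upwards [hρ0] with y hy
    simp only [Pi.zero_apply]; positivity

lemma subord_pow {Ω : Type*} [MeasurableSpace Ω] (m : Measure Ω) [SFinite m] (w q : Ω → ℝ)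
    (hw : Integrable w m) (hq : Measurable q) (hq0 : ∀ ω, 0 ≤ q ω) (M : ℝ)
    (H : ∀ v, 0 ≤ v → |∫ ω, w ω * Real.exp (-(v * q ω)) ∂m| ≤ M)
    (ν : Measure ℝ) [SFinite ν] (hν : ∀ᵐ y ∂ν, 0 ≤ y) (ρ : ℝ → ℝ) (hρm : Measurable ρ)
    (hρ : Integrable ρ ν) (hρ0 : ∀ᵐ y ∂ν, 0 ≤ ρ y) (k : ℕ) :
    ∀ v, 0 ≤ v → |∫ ω, w ω * Real.exp (-(v * q ω)) *
      (∫ y, ρ y * Real.exp (-(y * q ω)) ∂ν) ^ k ∂m| ≤ M * (∫ y, ρ y ∂ν) ^ k := by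
  induction k with
  | zero => simpa using H
  | succ k ih =>
    intro v hv
    set L : Ω → ℝ := fun ω => ∫ y, ρ y * Real.exp (-(y * q ω)) ∂ν with hL
    have hLm : Measurable L := L_meas q hq ν ρ hρm
    have hL0 : ∀ ω, 0 ≤ L ω := L_nonneg q ν ρ hρ0
    have hLN : ∀ ω, L ω ≤ ∫ y, ρ y ∂ν := L_le q hq0 ν ρ hρ hρ0 hν
    have e1 : ∀ ω, w ω * Real.exp (-(v * q ω)) * (L ω) ^ (k+1) =
        ∫ y, w ω * Real.exp (-((v + y) * q ω)) * (L ω) ^ k * ρ y ∂ν := by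
      intro ω
      have : ∀ y, w ω * Real.exp (-((v + y) * q ω)) * (L ω) ^ k * ρ y
          = (w ω * Real.exp (-(v * q ω)) * (L ω) ^ k) * (ρ y * Real.exp (-(y * q ω))) := by
        intro y
        rw [show -((v + y) * q ω) = -(v * q ω) + -(y * q ω) by ring, Real.exp_add]; ring
      rw [integral_congr_ae (Eventually.of_forall this), integral_const_mul, pow_succ]
      ring
    rw [integral_congr_ae (Eventually.of_forall e1)]
    have hint : Integrable (Function.uncurry fun (ω : Ω) (y : ℝ) =>
        w ω * Real.exp (-((v + y) * q ω)) * (L ω) ^ k * ρ y) (m.prod ν) := by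
      have hb : Integrable (fun z : Ω × ℝ => (‖w z.1‖ * (∫ y, ρ y ∂ν)^k) * ρ z.2) (m.prod ν) :=
        (hw.norm.mul_const _).mul_prod hρ
      refine hb.mono' ?_ ?_
      · simp only [Function.uncurry_def]
        have h1 : AEStronglyMeasurable (fun z : Ω × ℝ => w z.1) (m.prod ν) :=
          hw.aestronglyMeasurable.comp_fst
        have h2 : Measurable (fun z : Ω × ℝ => Real.exp (-((v + z.2) * q z.1)) * (L z.1) ^ k * ρ z.2) := by
          fun_prop
        have := h1.mul h2.aestronglyMeasurable
        refine this.congr (Eventually.of_forall fun z => ?_)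
        simp only [Pi.mul_apply]; ring
      · have h1 : ∀ᵐ z ∂(m.prod ν), 0 ≤ z.2 ∧ 0 ≤ ρ z.2 :=
          Measure.quasiMeasurePreserving_snd.ae (hν.and hρ0)
        filter_upwards [h1] with z hz
        simp only [Function.uncurry_def, norm_mul, norm_pow]
        rw [Real.norm_of_nonneg (hL0 z.1), Real.norm_of_nonneg hz.2, Real.norm_of_nonneg (Real.exp_pos _).le]
        have h2 : Real.exp (-((v + z.2) * q z.1)) ≤ 1 := by
          rw [Real.exp_le_one_iff]; have := mul_nonneg (add_nonneg hv hz.1) (hq0 z.1); linarith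
        have h3 := pow_le_pow_left₀ (hL0 z.1) (hLN z.1) k
        have h4 := hL0 z.1
        refine mul_le_mul_of_nonneg_right ?_ hz.2
        calc ‖w z.1‖ * Real.exp (-((v + z.2) * q z.1)) * L z.1 ^ k ≤ ‖w z.1‖ * 1 * (∫ y, ρ y ∂ν)^k := by
              gcongr
          _ = _ := by ring
    rw [integral_integral_swap hint]
    rw [← Real.norm_eq_abs]
    have : M * (∫ y, ρ y ∂ν)^(k+1) = ∫ y, (M * (∫ y, ρ y ∂ν)^k) * ρ y ∂ν := by
      rw [integral_const_mul]; ring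
    rw [this]
    refine norm_integral_le_of_norm_le (hρ.const_mul _) ?_
    filter_upwards [hν, hρ0] with y hy hy0
    rw [integral_mul_const, norm_mul, Real.norm_of_nonneg hy0]
    exact mul_le_mul_of_nonneg_right (ih (v + y) (add_nonneg hv hy)) hy0

lemma sub_exp {Ω : Type*} [MeasurableSpace Ω] (m : Measure Ω) [SFinite m] (w q : Ω → ℝ)
    (hw : Integrable w m) (hq : Measurable q) (hq0 : ∀ ω, 0 ≤ q ω) (M : ℝ)
    (H : ∀ v, 0 ≤ v → |∫ ω, w ω * Real.exp (-(v * q ω)) ∂m| ≤ M)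
    (ν : Measure ℝ) [SFinite ν] (hν : ∀ᵐ y ∂ν, 0 ≤ y) (ρ : ℝ → ℝ) (hρm : Measurable ρ)
    (hρ : Integrable ρ ν) (hρ0 : ∀ᵐ y ∂ν, 0 ≤ ρ y) :
    |∫ ω, w ω * Real.exp (-(∫ y, ρ y * (1 - Real.exp (-(y * q ω))) ∂ν)) ∂m| ≤ M := by
  set L : Ω → ℝ := fun ω => ∫ y, ρ y * Real.exp (-(y * q ω)) ∂ν with hL
  have hLm : Measurable L := L_meas q hq ν ρ hρm
  have hL0 : ∀ ω, 0 ≤ L ω := L_nonneg q ν ρ hρ0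
  have hLN : ∀ ω, L ω ≤ ∫ y, ρ y ∂ν := L_le q hq0 ν ρ hρ hρ0 hν
  have key := subord_pow m w q hw hq hq0 M H ν hν ρ hρm hρ hρ0
  set N := ∫ y, ρ y ∂ν with hN
  have hN0 : 0 ≤ N := integral_nonneg_of_ae hρ0
  have e1 : ∀ ω, ∫ y, ρ y * (1 - Real.exp (-(y * q ω))) ∂ν = N - L ω := by
    intro ω
    simp only [mul_sub, mul_one]
    rw [integral_sub hρ]
    refine hρ.mono' (by fun_prop) ?_
    filter_upwards [hν, hρ0] with y hy hy0
    rw [norm_mul, Real.norm_of_nonneg hy0, Real.norm_of_nonneg (Real.exp_pos _).le]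
    have h2 : Real.exp (-(y * q ω)) ≤ 1 := by
      rw [Real.exp_le_one_iff]; have := mul_nonneg hy (hq0 ω); linarith
    nlinarith
  simp_rw [e1]
  let F : ℕ → Ω → ℝ := fun k ω => w ω * L ω ^ k * ((k.factorial : ℝ)⁻¹ * Real.exp (-N))
  have hF : ∀ k, Integrable (F k) m := by
    intro k
    apply Integrable.mul_const
    refine (hw.norm.mul_const (N^k)).mono' (hw.aestronglyMeasurable.mul (hLm.pow_const k).aestronglyMeasurable) ?_
    refine Eventually.of_forall fun ω => ?_
    rw [norm_mul, norm_pow, Real.norm_of_nonneg (hL0 ω)]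
    have := hL0 ω
    have := hLN ω
    gcongr
  have hexp : HasSum (fun k : ℕ => N ^ k * ((k.factorial : ℝ)⁻¹)) (Real.exp N) := by
    have := NormedSpace.expSeries_div_hasSum_exp N
    rw [← Real.exp_eq_exp_ℝ] at this
    simpa [div_eq_mul_inv] using this
  have hS : Summable fun k => ∫ ω, ‖F k ω‖ ∂m := by
    refine Summable.of_nonneg_of_le (fun k => integral_nonneg fun ω => norm_nonneg _) (fun k => ?_)
      (((hexp.summable).mul_left (∫ ω, ‖w ω‖ ∂m)).mul_right (Real.exp (-N)))
    rw [← integral_mul_const, ← integral_mul_const]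
    refine integral_mono (hF k).norm ((hw.norm.mul_const _).mul_const _) fun ω => ?_
    simp only [F, norm_mul, norm_pow]
    rw [Real.norm_of_nonneg (hL0 ω), Real.norm_of_nonneg (Real.exp_pos _).le, 
      Real.norm_of_nonneg (by positivity : 0 ≤ (k.factorial : ℝ)⁻¹)]
    have := hL0 ω
    have := hLN ω
    rw [mul_assoc, mul_assoc, mul_assoc]
    gcongr
  have hs := hasSum_integral_of_summable_integral_norm hF hS
  have e2 : ∀ ω, ∑' k, F k ω = w ω * Real.exp (-(N - L ω)) := by
    intro ω
    have := NormedSpace.expSeries_div_hasSum_exp (L ω)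
    rw [← Real.exp_eq_exp_ℝ] at this
    have h2 := (this.mul_left (w ω * Real.exp (-N))).tsum_eq
    rw [show -(N - L ω) = -N + L ω by ring, Real.exp_add, ← mul_assoc, ← h2]
    congr 1; ext k; simp only [F]; rw [div_eq_mul_inv]; ring
  simp_rw [e2] at hs
  rw [← hs.tsum_eq, ← Real.norm_eq_abs]
  have hB := (hexp.mul_left M).mul_right (Real.exp (-N))
  rw [mul_assoc, ← Real.exp_add, add_neg_cancel, Real.exp_zero, mul_one] at hB
  refine tsum_of_norm_bounded hB fun k => ?_
  simp only [F]
  rw [integral_mul_const, norm_mul, Real.norm_of_nonneg (by positivity : 0 ≤ (k.factorial : ℝ)⁻¹ * Real.exp (-N))]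
  have := key k 0 le_rfl
  simp only [zero_mul, neg_zero, Real.exp_zero, mul_one] at this
  calc _ ≤ M * N ^ k * ((k.factorial : ℝ)⁻¹ * Real.exp (-N)) := 
        mul_le_mul_of_nonneg_right this (by positivity)
    _ = _ := by ring

lemma psi_integrable (a : ℝ) (ha : a ∈ Ioo (0:ℝ) 1) (l : ℝ) (hl : 0 ≤ l) :
    IntegrableOn (fun y : ℝ => y ^ (-1 - a) * (1 - Real.exp (-(y * l)))) (Ioi 0) := by
  obtain ⟨h0, h1⟩ := ha
  rw [← Ioc_union_Ioi_eq_Ioi zero_le_one]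
  apply IntegrableOn.union
  · have : IntegrableOn (fun y : ℝ => y ^ (-a) * l) (Ioc 0 1) := by
      apply Integrable.mul_const
      have := (intervalIntegral.intervalIntegrable_rpow' (a := 0) (b := 1) (r := -a) (by linarith))
      rwa [intervalIntegrable_iff_integrableOn_Ioc_of_le zero_le_one] at this
    refine Integrable.mono' this (Measurable.aestronglyMeasurable (by fun_prop)) ?_
    refine (ae_restrict_iff' measurableSet_Ioc).2 (Eventually.of_forall fun y hy => ?_)
    have hy0 : 0 < y := hy.1
    have hE : Real.exp (-(y * l)) ≤ 1 := by
      rw [Real.exp_le_one_iff]; nlinarith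
    rw [Real.norm_of_nonneg (mul_nonneg (by positivity) (by linarith))]
    have h2 : 1 - Real.exp (-(y * l)) ≤ y * l := by
      have := Real.add_one_le_exp (-(y*l)); linarith
    calc _ ≤ y ^ (-1 - a) * (y * l) := by gcongr
      _ = y ^ (-a) * l := by
        rw [show -a = (-1 - a) + 1 by ring, Real.rpow_add_one hy0.ne']; ring_nf
  · refine Integrable.mono' (integrableOn_Ioi_rpow_of_lt (a := -1 - a) (by linarith) zero_lt_one)
      (Measurable.aestronglyMeasurable (by fun_prop)) ?_
    refine (ae_restrict_iff' measurableSet_Ioi).2 (Eventually.of_forall fun y hy => ?_)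
    have hy0 : (0:ℝ) < y := lt_trans zero_lt_one hy
    have hE : Real.exp (-(y * l)) ≤ 1 := by
      rw [Real.exp_le_one_iff]; nlinarith
    rw [Real.norm_of_nonneg (mul_nonneg (by positivity) (by linarith))]
    have h2 : 1 - Real.exp (-(y * l)) ≤ 1 := by
      have := Real.exp_pos (-(y*l)); linarith
    calc _ ≤ y ^ (-1 - a) * 1 := by gcongr
      _ = _ := by ring

lemma psi_eq (a : ℝ) (ha : a ∈ Ioo (0:ℝ) 1) (l : ℝ) (hl : 0 ≤ l) :
    ∫ y in Ioi (0:ℝ), y ^ (-1 - a) * (1 - Real.exp (-(y * l))) =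
      l ^ a * ∫ y in Ioi (0:ℝ), y ^ (-1 - a) * (1 - Real.exp (-y)) := by
  rcases hl.eq_or_lt with rfl | hl
  · simp [Real.zero_rpow ha.1.ne']
  have h := integral_comp_mul_left_Ioi (fun y : ℝ => y ^ (-1 - a) * (1 - Real.exp (-y))) 0 hl
  rw [mul_zero, smul_eq_mul] at h
  have h2 : ∫ y in Ioi (0:ℝ), y ^ (-1 - a) * (1 - Real.exp (-y)) = 
      l * ∫ x in Ioi (0:ℝ), (l * x) ^ (-1 - a) * (1 - Real.exp (-(l * x))) := by
    rw [h]; field_simp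
  rw [h2, ← integral_const_mul, ← integral_const_mul]
  refine setIntegral_congr_fun measurableSet_Ioi fun y hy => ?_
  have hy0 : (0:ℝ) < y := hy
  rw [Real.mul_rpow hl.le hy0.le, mul_comm y l]
  have : l ^ a * (l * l ^ (-1 - a)) = 1 := by
    rw [mul_comm l, ← Real.rpow_add_one hl.ne', ← Real.rpow_add hl]
    ring_nf; simp
  calc _ = (l ^ a * (l * l ^ (-1 - a))) * (y ^ (-1 - a) * (1 - Real.exp (-(l * y)))) := by rw [this, one_mul]
    _ = _ := by ring

lemma psi_pos (a : ℝ) (ha : a ∈ Ioo (0:ℝ) 1) :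
    0 < ∫ y in Ioi (0:ℝ), y ^ (-1 - a) * (1 - Real.exp (-y)) := by
  have hpos : ∀ y ∈ Ioi (0:ℝ), 0 < y ^ (-1 - a) * (1 - Real.exp (-y)) := by
    intro y hy
    have hy0 : (0:ℝ) < y := hy
    have : Real.exp (-y) < 1 := by rw [Real.exp_lt_one_iff]; linarith
    exact mul_pos (by positivity) (by linarith)
  rw [setIntegral_pos_iff_support_of_nonneg_ae]
  · have : Function.support (fun y : ℝ => y ^ (-1 - a) * (1 - Real.exp (-y))) ∩ Ioi 0 = Ioi 0 := by
      apply inter_eq_right.2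
      intro y hy
      exact (hpos y hy).ne'
    rw [this]; simp
  · exact (ae_restrict_iff' measurableSet_Ioi).2 (Eventually.of_forall fun y hy => (hpos y hy).le)
  · simpa using psi_integrable a ha 1 zero_le_one

lemma subord {Ω : Type*} [MeasurableSpace Ω] (m : Measure Ω) [SFinite m] (w q : Ω → ℝ)
    (hw : Integrable w m) (hq : Measurable q) (hq0 : ∀ ω, 0 ≤ q ω) (M : ℝ)
    (H : ∀ v, 0 ≤ v → |∫ ω, w ω * Real.exp (-(v * q ω)) ∂m| ≤ M)
    (a : ℝ) (ha : a ∈ Ioo (0:ℝ) 1) (s : ℝ) (hs : 0 ≤ s) :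
    |∫ ω, w ω * Real.exp (-(s * q ω ^ a)) ∂m| ≤ M := by
  set K := ∫ y in Ioi (0:ℝ), y ^ (-1 - a) * (1 - Real.exp (-y)) with hK
  have hKpos : 0 < K := psi_pos a ha
  let ρ : ℝ → ℝ := fun y => s / K * y ^ (-1 - a)
  have hρm : Measurable ρ := by fun_prop
  let S : ℕ → Set ℝ := fun n => Ioi (1 / ((n:ℝ) + 1))
  have hS : ∀ n, S n ⊆ Ioi 0 := fun n => Ioi_subset_Ioi (by positivity)
  have hmono : Monotone S := by
    intro i j hij
    apply Ioi_subset_Ioi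
    exact one_div_le_one_div_of_le (by positivity) (by gcongr)
  have hU : ⋃ n, S n = Ioi 0 := by
    apply Subset.antisymm (iUnion_subset hS)
    intro y hy
    obtain ⟨n, hn⟩ := exists_nat_one_div_lt (show (0:ℝ) < y from hy)
    exact mem_iUnion.2 ⟨n, hn⟩
  have hb : ∀ n, |∫ ω, w ω * Real.exp (-(∫ y in S n, ρ y * (1 - Real.exp (-(y * q ω))))) ∂m| ≤ M := by
    intro n
    refine sub_exp m w q hw hq hq0 M H (volume.restrict (S n)) ?_ ρ hρm ?_ ?_
    · exact (ae_restrict_iff' measurableSet_Ioi).2 (Eventually.of_forall fun y hy => (hS n hy).le)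
    · exact (integrableOn_Ioi_rpow_of_lt (by linarith [ha.1]) (by positivity)).const_mul _
    · refine (ae_restrict_iff' measurableSet_Ioi).2 (Eventually.of_forall fun y hy => ?_)
      have : (0:ℝ) < y := hS n hy
      simp only [ρ]; positivity
  have hin : ∀ ω, IntegrableOn (fun y => ρ y * (1 - Real.exp (-(y * q ω)))) (Ioi 0) := by
    intro ω
    have := (psi_integrable a ha (q ω) (hq0 ω)).const_mul (s / K)
    simp only [ρ, mul_assoc]
    exact this
  have hlim : ∀ ω, Tendsto (fun n => ∫ y in S n, ρ y * (1 - Real.exp (-(y * q ω)))) atTop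
      (nhds (s * q ω ^ a)) := by
    intro ω
    have h1 := tendsto_setIntegral_of_monotone (μ := volume) (s := S)
      (f := fun y => ρ y * (1 - Real.exp (-(y * q ω)))) (fun n => measurableSet_Ioi) hmono
      (by rw [hU]; exact hin ω)
    rw [hU] at h1
    convert h1 using 2
    simp only [ρ, mul_assoc]
    rw [integral_const_mul, psi_eq a ha _ (hq0 ω), ← hK]
    field_simp
  have ht : Tendsto (fun n => ∫ ω, w ω * Real.exp (-(∫ y in S n, ρ y * (1 - Real.exp (-(y * q ω))))) ∂m)
      atTop (nhds (∫ ω, w ω * Real.exp (-(s * q ω ^ a)) ∂m)) := by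
    refine tendsto_integral_of_dominated_convergence (fun ω => ‖w ω‖) ?_ hw.norm ?_ ?_
    · intro n
      refine hw.aestronglyMeasurable.mul ?_
      have : StronglyMeasurable (Function.uncurry fun (ω : Ω) (y : ℝ) => ρ y * (1 - Real.exp (-(y * q ω)))) := by
        apply Measurable.stronglyMeasurable
        simp only [Function.uncurry_def]
        fun_prop
      have h2 := (this.integral_prod_right (ν := volume.restrict (S n))).measurable
      exact (Real.measurable_exp.comp h2.neg).aestronglyMeasurable
    · intro n
      refine Eventually.of_forall fun ω => ?_
      rw [norm_mul, Real.norm_of_nonneg (Real.exp_pos _).le]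
      have : 0 ≤ ∫ y in S n, ρ y * (1 - Real.exp (-(y * q ω))) := by
        refine setIntegral_nonneg measurableSet_Ioi fun y hy => ?_
        have hy0 : (0:ℝ) < y := hS n hy
        have hE : Real.exp (-(y * q ω)) ≤ 1 := by
          rw [Real.exp_le_one_iff]; nlinarith [mul_nonneg hy0.le (hq0 ω)]
        exact mul_nonneg (by simp only [ρ]; positivity) (by linarith)
      have h2 : Real.exp (-(∫ y in S n, ρ y * (1 - Real.exp (-(y * q ω))))) ≤ 1 := by
        rw [Real.exp_le_one_iff]; linarith
      exact mul_le_of_le_one_right (norm_nonneg _) h2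
    · refine Eventually.of_forall fun ω => ?_
      exact ((Real.continuous_exp.tendsto _).comp (hlim ω).neg).const_mul _
  exact le_of_tendsto ht.abs (Eventually.of_forall hb)

lemma gauss_int (d : ℕ) (b : ℝ) (hb : 0 < b) (x : Ed d) (θ : ℝ) :
    ∫ z : Ed d, Real.cos (⟪x, z⟫ - θ) * Real.exp (-(b * ‖z‖ ^ 2)) =
      Real.cos θ * ((π / b) ^ ((d : ℝ) / 2) * Real.exp (-(‖x‖ ^ 2 / (4 * b)))) := by
  have hb' : 0 < (b : ℂ).re := by simpa using hb
  have h1 := GaussianFourier.integral_cexp_neg_mul_sq_norm_add hb' Complex.I x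
  have h2 := GaussianFourier.integrable_cexp_neg_mul_sq_norm_add hb' Complex.I x
  have h3 := h2.mul_const (Complex.exp (-(θ * Complex.I)))
  have h4 := Complex.reCLM.integral_comp_comm h3
  have e : ∀ z : Ed d, Complex.reCLM (Complex.exp (-(b:ℂ) * (‖z‖ : ℂ) ^ 2 + Complex.I * (⟪x, z⟫ : ℝ)) *
      Complex.exp (-(θ * Complex.I))) = Real.cos (⟪x, z⟫ - θ) * Real.exp (-(b * ‖z‖ ^ 2)) := by
    intro z
    rw [← Complex.exp_add]
    rw [show -(b:ℂ) * (‖z‖ : ℂ) ^ 2 + Complex.I * (⟪x, z⟫ : ℝ) + -(θ * Complex.I)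
      = ((-(b * ‖z‖^2) : ℝ) : ℂ) + ((⟪x, z⟫ - θ : ℝ) : ℂ) * Complex.I by push_cast; ring]
    rw [Complex.exp_add, ← Complex.ofReal_exp]
    simp only [Complex.reCLM_apply, Complex.re_ofReal_mul, Complex.exp_ofReal_mul_I_re]
    ring
  simp_rw [e] at h4
  rw [h4, integral_mul_const, h1]
  rw [finrank_euclideanSpace_fin]
  have hp : ((π : ℂ) / b) ^ ((d : ℂ) / 2) = (((π / b) ^ ((d : ℝ) / 2) : ℝ) : ℂ) := by
    rw [Complex.ofReal_cpow (by positivity)]; push_cast; rfl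
  have hx : Complex.exp (Complex.I ^ 2 * (‖x‖:ℂ) ^ 2 / (4 * b)) = ((Real.exp (-(‖x‖ ^ 2 / (4 * b))) : ℝ) : ℂ) := by
    push_cast; rw [Complex.I_sq]; ring_nf
  rw [hp, hx, show -((θ:ℂ) * Complex.I) = ((-θ : ℝ):ℂ) * Complex.I by push_cast; ring, ← Complex.ofReal_mul]
  simp only [Complex.reCLM_apply, Complex.re_ofReal_mul, Complex.exp_ofReal_mul_I_re]
  rw [Real.cos_neg]; ring

lemma gauss_integrable (d : ℕ) (b : ℝ) (hb : 0 < b) :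
    Integrable (fun z : Ed d => Real.exp (-(b * ‖z‖ ^ 2))) := by
  have hb' : 0 < (b : ℂ).re := by simpa using hb
  have h2 := (GaussianFourier.integrable_cexp_neg_mul_sq_norm_add hb' 0 (0 : Ed d)).norm
  refine h2.congr (Eventually.of_forall fun z => ?_)
  simp only [Complex.norm_exp]
  congr 1
  simp [← Complex.ofReal_pow]

/-- Fourier weight. -/
def wt (d : ℕ) (u : ℝ) (x ξ : Ed d) : ℝ :=
  (2 * π) ^ (-(d : ℝ)) * (π / u) ^ ((d : ℝ) / 2) * (Real.cos ⟪x, ξ⟫ * Real.exp (-(1 / (4 * u) * ‖ξ‖ ^ 2)))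

lemma wt_integrable (d : ℕ) (u : ℝ) (hu : 0 < u) (x : Ed d) : Integrable (wt d u x) := by
  unfold wt
  apply Integrable.const_mul
  refine (gauss_integrable d (1 / (4 * u)) (by positivity)).mono' (by fun_prop) 
    (Eventually.of_forall fun ξ => ?_)
  rw [norm_mul, Real.norm_of_nonneg (Real.exp_pos _).le]
  exact mul_le_of_le_one_left (Real.exp_pos _).le (by simpa using Real.abs_cos_le_one _)

lemma const_eq (d : ℕ) (u : ℝ) (hu : 0 < u) :
    (2 * π) ^ (-(d : ℝ)) * (π / u) ^ ((d : ℝ) / 2) = (1 / (4 * π * u)) ^ ((d : ℝ) / 2) := by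
  have hpi := Real.pi_pos
  have : (2 * π) ^ (-(d : ℝ)) = (1 / (2 * π) ^ 2) ^ ((d : ℝ) / 2) := by
    rw [one_div, Real.inv_rpow (by positivity), ← Real.rpow_natCast (2 * π) 2, ← Real.rpow_mul (by positivity),
      Real.rpow_neg (by positivity)]
    congr 2; push_cast; ring
  rw [this, ← Real.mul_rpow (by positivity) (by positivity)]
  congr 1
  field_simp
  norm_num

lemma wt_gauss (d : ℕ) (u : ℝ) (hu : 0 < u) (x : Ed d) (v : ℝ) (hv : 0 ≤ v) :
    ∫ ξ, wt d u x ξ * Real.exp (-(v * ‖ξ‖ ^ 2)) =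
      (1 / (4 * u * (1 / (4 * u) + v))) ^ ((d : ℝ) / 2) *
        Real.exp (-(‖x‖ ^ 2 / (4 * (1 / (4 * u) + v)))) := by
  have hb : 0 < 1 / (4 * u) + v := by positivity
  have hpi := Real.pi_pos
  have h := gauss_int d (1 / (4 * u) + v) hb x 0
  simp only [sub_zero, Real.cos_zero, one_mul] at h
  have e : ∀ ξ, wt d u x ξ * Real.exp (-(v * ‖ξ‖ ^ 2)) =
    (2 * π) ^ (-(d : ℝ)) * (π / u) ^ ((d : ℝ) / 2) * 
      (Real.cos ⟪x, ξ⟫ * Real.exp (-((1 / (4 * u) + v) * ‖ξ‖ ^ 2))) := by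
    intro ξ
    unfold wt
    rw [show -((1 / (4 * u) + v) * ‖ξ‖ ^ 2) = -(1 / (4 * u) * ‖ξ‖ ^ 2) + -(v * ‖ξ‖ ^ 2) by ring, Real.exp_add]
    ring
  rw [integral_congr_ae (Eventually.of_forall e), integral_const_mul, h, const_eq d u hu, ← mul_assoc,
    ← Real.mul_rpow (by positivity) (by positivity)]
  congr 2
  field_simp

lemma rpow_mul_exp_le (e Y : ℝ) (he : 0 < e) (hY : 0 ≤ Y) : Y ^ e * Real.exp (-Y) ≤ e ^ e := by
  have h1 : Y ≤ e * Real.exp (Y / e) := by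
    have := Real.add_one_le_exp (Y / e)
    have h2 : Y = e * (Y / e) := by field_simp
    calc Y = e * (Y / e) := h2
      _ ≤ _ := by gcongr; linarith
  have h2 : Y ^ e ≤ e ^ e * Real.exp Y := by
    calc Y ^ e ≤ (e * Real.exp (Y / e)) ^ e := by gcongr
      _ = _ := by
        rw [Real.mul_rpow he.le (Real.exp_pos _).le, ← Real.exp_mul]
        congr 2; field_simp
  calc _ ≤ e ^ e * Real.exp Y * Real.exp (-Y) := by gcongr
    _ = _ := by rw [mul_assoc, ← Real.exp_add]; simp

lemma wt_gauss_bound (d : ℕ) (hd : 0 < d) (u : ℝ) (hu : 0 < u) (x : Ed d) (hx : x ≠ 0) (v : ℝ) (hv : 0 ≤ v) :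
    |∫ ξ, wt d u x ξ * Real.exp (-(v * ‖ξ‖ ^ 2))| ≤
      ((d : ℝ) / 2) ^ ((d : ℝ) / 2) * (u * ‖x‖ ^ 2) ^ (-((d : ℝ) / 2)) := by
  have hx' : 0 < ‖x‖ := norm_pos_iff.2 hx
  have hd' : (0:ℝ) < d := by exact_mod_cast hd
  rw [wt_gauss d u hu x v hv, abs_of_nonneg (by positivity)]
  set b := 1 / (4 * u) + v
  have hb : 0 < b := by positivity
  have h := rpow_mul_exp_le ((d : ℝ) / 2) (‖x‖ ^ 2 / (4 * b)) (by positivity) (by positivity)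
  have e : 1 / (4 * u * b) = (‖x‖ ^ 2 / (4 * b)) * (u * ‖x‖ ^ 2)⁻¹ := by field_simp
  rw [e, Real.mul_rpow (by positivity) (by positivity), Real.inv_rpow (by positivity), 
    Real.rpow_neg (by positivity)]
  calc _ = ((‖x‖ ^ 2 / (4 * b)) ^ ((d : ℝ) / 2) * Real.exp (-(‖x‖ ^ 2 / (4 * b)))) * 
        ((u * ‖x‖ ^ 2) ^ ((d : ℝ) / 2))⁻¹ := by ring
    _ ≤ _ := by gcongr

lemma A_bound_x (d : ℕ) (hd : 0 < d) (α : ℝ) (hα : α ∈ Ioo (0:ℝ) 2) (u : ℝ) (hu : 0 < u) (x : Ed d) (hx : x ≠ 0)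
    (s : ℝ) (hs : 0 < s) :
    |∫ ξ, wt d u x ξ * Real.exp (-(s * ‖ξ‖ ^ α))| ≤
      ((d : ℝ) / 2) ^ ((d : ℝ) / 2) * (u * ‖x‖ ^ 2) ^ (-((d : ℝ) / 2)) := by
  have := subord volume (wt d u x) (fun ξ => ‖ξ‖ ^ 2) (wt_integrable d u hu x) (by fun_prop)
    (fun ξ => by positivity) _ (wt_gauss_bound d hd u hu x hx) (α / 2)
    ⟨by linarith [hα.1], by linarith [hα.2]⟩ s hs.le
  convert this using 8 with ξ
  rw [← Real.rpow_natCast ‖ξ‖ 2, ← Real.rpow_mul (norm_nonneg _)]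
  congr 1; push_cast; ring

lemma A_bound_one (d : ℕ) (α : ℝ) (u : ℝ) (hu : 0 < u) (x : Ed d)
    (s : ℝ) (hs : 0 < s) :
    |∫ ξ, wt d u x ξ * Real.exp (-(s * ‖ξ‖ ^ α))| ≤ 1 := by
  have h := wt_gauss d u hu 0 0 le_rfl
  have h1 : ∫ ξ, wt d u 0 ξ = 1 := by
    simp only [zero_mul, neg_zero, Real.exp_zero, mul_one, norm_zero] at h
    rw [h]
    have : 1 / (4 * u * (1 / (4 * u) + 0)) = 1 := by field_simp; simp
    rw [this]; simp
  rw [← Real.norm_eq_abs, ← h1]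
  refine norm_integral_le_of_norm_le (wt_integrable d u hu 0) (Eventually.of_forall fun ξ => ?_)
  have hE : Real.exp (-(s * ‖ξ‖ ^ α)) ≤ 1 := by
    rw [Real.exp_le_one_iff]; have : 0 ≤ s * ‖ξ‖ ^ α := by positivity
    linarith
  rw [norm_mul, Real.norm_of_nonneg (Real.exp_pos _).le]
  refine (mul_le_of_le_one_right (norm_nonneg _) hE).trans ?_
  unfold wt
  have hpi := Real.pi_pos
  rw [norm_mul, norm_mul, Real.norm_of_nonneg (by positivity), Real.norm_of_nonneg (by positivity)]
  have := Real.abs_cos_le_one ⟪x, ξ⟫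
  simp only [inner_zero_left, Real.cos_zero, Real.norm_eq_abs]
  rw [abs_mul, abs_of_nonneg (Real.exp_pos _).le]
  gcongr

lemma stable_integrable (d : ℕ) (hd : 0 < d) (α : ℝ) (hα : 0 < α) (s : ℝ) (hs : 0 < s) :
    Integrable (fun ξ : Ed d => Real.exp (-(s * ‖ξ‖ ^ α))) := by
  have : Nonempty (Fin d) := ⟨⟨0, hd⟩⟩
  have := (integrable_fun_norm_addHaar (volume : Measure (Ed d)) (f := fun r => Real.exp (-(s * r ^ α)))).2
  apply this
  have h := integrableOn_rpow_mul_exp_neg_mul_rpow (p := α) (s := ((d - 1 : ℕ) : ℝ)) (b := s) 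
    (by have : (0:ℝ) ≤ ((d - 1 : ℕ) : ℝ) := by positivity
        linarith) hα hs
  refine h.congr_fun (fun y hy => ?_) measurableSet_Ioi
  simp only [finrank_euclideanSpace_fin, smul_eq_mul, Real.rpow_natCast, neg_mul]

lemma stable_scale (d : ℕ) (α : ℝ) (hα : 0 < α) (s : ℝ) (hs : 0 < s) :
    ∫ ξ : Ed d, Real.exp (-(s * ‖ξ‖ ^ α)) = 
      ((s ^ (1 / α)) ^ d)⁻¹ * ∫ ξ : Ed d, Real.exp (-(‖ξ‖ ^ α)) := by
  have h := Measure.integral_comp_smul (volume : Measure (Ed d)) 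
    (fun ξ => Real.exp (-(‖ξ‖ ^ α))) (s ^ (1 / α))
  rw [finrank_euclideanSpace_fin, abs_of_nonneg (by positivity), smul_eq_mul] at h
  rw [← h]
  congr 1; ext ξ
  rw [norm_smul, Real.norm_of_nonneg (by positivity), Real.mul_rpow (by positivity) (norm_nonneg _),
    ← Real.rpow_mul hs.le]
  congr 3
  rw [one_div_mul_cancel hα.ne', Real.rpow_one]

lemma A_bound_s (d : ℕ) (hd : 0 < d) (α : ℝ) (hα : 0 < α) (u : ℝ) (hu : 0 < u) (x : Ed d)
    (s : ℝ) (hs : 0 < s) :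
    |∫ ξ, wt d u x ξ * Real.exp (-(s * ‖ξ‖ ^ α))| ≤
      ((1 / (4 * π)) ^ ((d : ℝ) / 2) * ∫ ξ : Ed d, Real.exp (-(‖ξ‖ ^ α))) 
        * (u * (s ^ (1 / α)) ^ 2) ^ (-((d : ℝ) / 2)) := by
  have hpi := Real.pi_pos
  have e : ((1 / (4 * π)) ^ ((d : ℝ) / 2) * ∫ ξ : Ed d, Real.exp (-(‖ξ‖ ^ α))) 
        * (u * (s ^ (1 / α)) ^ 2) ^ (-((d : ℝ) / 2)) = 
        ∫ ξ : Ed d, (1 / (4 * π * u)) ^ ((d : ℝ) / 2) * Real.exp (-(s * ‖ξ‖ ^ α)) := by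
    rw [integral_const_mul, stable_scale d α hα s hs]
    have h1 : (1 / (4 * π * u)) ^ ((d : ℝ) / 2) = (1 / (4 * π)) ^ ((d : ℝ) / 2) * u ^ (-((d : ℝ) / 2)) := by
      rw [Real.rpow_neg hu.le, ← Real.inv_rpow hu.le, ← Real.mul_rpow (by positivity) (by positivity)]
      congr 1; field_simp
    have h2 : (u * (s ^ (1 / α)) ^ 2) ^ (-((d : ℝ) / 2)) = u ^ (-((d : ℝ) / 2)) * ((s ^ (1 / α)) ^ d)⁻¹ := by
      rw [Real.mul_rpow hu.le (by positivity)]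
      congr 1
      rw [Real.rpow_neg (by positivity), ← Real.rpow_natCast (s ^ (1 / α)) 2, ← Real.rpow_mul (by positivity),
        ← Real.rpow_natCast (s ^ (1 / α)) d]
      congr 2; push_cast; ring
    rw [h1, h2]; ring
  rw [e, ← Real.norm_eq_abs]
  refine norm_integral_le_of_norm_le ((stable_integrable d hd α hα s hs).const_mul _) 
    (Eventually.of_forall fun ξ => ?_)
  rw [norm_mul, Real.norm_of_nonneg (Real.exp_pos _).le]
  refine mul_le_mul_of_nonneg_right ?_ (Real.exp_pos _).le
  unfold wt
  rw [const_eq d u hu, norm_mul, norm_mul, Real.norm_of_nonneg (by positivity), Real.norm_of_nonneg (Real.exp_pos _).le]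
  refine mul_le_of_le_one_right (by positivity) (mul_le_one₀ (by simpa using Real.abs_cos_le_one _) (Real.exp_pos _).le ?_)
  rw [Real.exp_le_one_iff]
  have : 0 ≤ 1 / (4 * u) * ‖ξ‖ ^ 2 := by positivity
  linarith

lemma frac_gauss (d : ℕ) (hd : 0 < d) (α : ℝ) (hα : 0 < α) (u : ℝ) (hu : 0 < u) (x : Ed d)
    (s : ℝ) (hs : 0 < s) :
    ∫ z, fracKernel d α s x z * Real.exp (-(u * ‖z‖ ^ 2)) = 
      ∫ ξ, wt d u x ξ * Real.exp (-(s * ‖ξ‖ ^ α)) := by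
  have e1 : ∀ z, fracKernel d α s x z * Real.exp (-(u * ‖z‖ ^ 2)) =
      ∫ ξ : Ed d, (2 * π) ^ (-(d : ℝ)) * (Real.cos ⟪z - x, ξ⟫ * 
        (Real.exp (-(s * ‖ξ‖ ^ α)) * Real.exp (-(u * ‖z‖ ^ 2)))) := by
    intro z
    unfold fracKernel
    rw [integral_const_mul, mul_assoc, ← integral_mul_const]
    congr 2; ext ξ; rw [neg_mul]; ring
  rw [integral_congr_ae (Eventually.of_forall e1), integral_integral_swap]
  · congr 1; ext ξ
    rw [integral_const_mul]
    have e2 : ∀ z : Ed d, Real.cos ⟪z - x, ξ⟫ * 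
        (Real.exp (-(s * ‖ξ‖ ^ α)) * Real.exp (-(u * ‖z‖ ^ 2))) = 
        Real.exp (-(s * ‖ξ‖ ^ α)) * (Real.cos (⟪ξ, z⟫ - ⟪x, ξ⟫) * Real.exp (-(u * ‖z‖ ^ 2))) := by
      intro z
      rw [inner_sub_left, real_inner_comm ξ z]; ring
    rw [integral_congr_ae (Eventually.of_forall e2), integral_const_mul, gauss_int d u hu ξ]
    unfold wt
    rw [show ‖ξ‖ ^ 2 / (4 * u) = 1 / (4 * u) * ‖ξ‖ ^ 2 by ring]
    ring
  · simp only [Function.uncurry_def]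
    apply Integrable.const_mul
    have hb : Integrable (fun z : Ed d × Ed d => Real.exp (-(u * ‖z.1‖ ^ 2)) * Real.exp (-(s * ‖z.2‖ ^ α))) 
      (volume.prod volume) :=
      (gauss_integrable d u hu).mul_prod (stable_integrable d hd α hα s hs)
    refine hb.mono' ?_ (Eventually.of_forall fun z => ?_)
    · apply Measurable.aestronglyMeasurable
      fun_prop
    · rw [norm_mul, norm_mul, Real.norm_of_nonneg (Real.exp_pos _).le, Real.norm_of_nonneg (Real.exp_pos _).le,
        mul_comm (Real.exp (-(u * ‖z.1‖ ^ 2)))]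
      exact mul_le_of_le_one_left (by positivity) (by simpa using Real.abs_cos_le_one _)

lemma frac_meas (d : ℕ) (α : ℝ) (x : Ed d) (s : ℝ) : Measurable (fun z => fracKernel d α s x z) := by
  unfold fracKernel
  have : StronglyMeasurable (Function.uncurry fun (z ξ : Ed d) => Real.cos ⟪z - x, ξ⟫ * Real.exp (-s * ‖ξ‖ ^ α)) := by
    apply Measurable.stronglyMeasurable
    simp only [Function.uncurry_def]
    fun_prop
  exact this.integral_prod_right.measurable.const_mul _

lemma radial_bound (β δ C R : ℝ) (hβ : 0 < β) (hδ : β < δ) (hR : 0 < R) (F : ℝ → ℝ)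
    (h1 : ∀ u, 0 < u → |F u| ≤ 1) (h2 : ∀ u, 0 < u → |F u| ≤ C * (u * R ^ 2) ^ (-(δ / 2))) 
    (hC : 0 ≤ C) :
    ∫ u in Ioi (0:ℝ), u ^ (β / 2 - 1) * F u ≤ (2 / β + 2 * C / (δ - β)) * R ^ (-β) := by
  have hδβ : 0 < δ - β := by linarith
  by_cases hi : IntegrableOn (fun u => u ^ (β / 2 - 1) * F u) (Ioi (0:ℝ))
  swap
  · rw [integral_undef hi]; positivity
  set r : ℝ := R ^ (-2 : ℝ) with hr
  have hr0 : 0 < r := by positivity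
  have hrp : ∀ p : ℝ, r ^ p = R ^ (-2 * p) := fun p => by rw [hr, ← Real.rpow_mul hR.le]
  rw [← Ioc_union_Ioi_eq_Ioi hr0.le] at hi ⊢
  rw [setIntegral_union (Ioc_disjoint_Ioi le_rfl) measurableSet_Ioi (hi.mono_set subset_union_left) 
    (hi.mono_set subset_union_right), add_mul]
  apply add_le_add
  · refine (le_abs_self _).trans ?_
    have hint : IntervalIntegrable (fun u : ℝ => u ^ (β / 2 - 1)) volume 0 r :=
      intervalIntegral.intervalIntegrable_rpow' (by linarith)
    have hg := (intervalIntegrable_iff_integrableOn_Ioc_of_le hr0.le).1 hint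
    have hv : ∫ u in Ioc 0 r, u ^ (β / 2 - 1) = 2 / β * R ^ (-β) := by
      rw [← intervalIntegral.integral_of_le hr0.le, integral_rpow (Or.inl (by linarith))]
      rw [sub_add_cancel, Real.zero_rpow (by positivity), hrp]
      rw [show -2 * (β / 2) = -β by ring]
      field_simp; ring
    rw [← hv, ← Real.norm_eq_abs]
    refine norm_integral_le_of_norm_le hg ((ae_restrict_iff' measurableSet_Ioc).2 (Eventually.of_forall fun u hu => ?_))
    have hu0 : 0 < u := hu.1
    rw [norm_mul, Real.norm_of_nonneg (by positivity)]
    exact mul_le_of_le_one_right (by positivity) (h1 u hu0)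
  · refine (le_abs_self _).trans ?_
    have hexp : β / 2 - 1 - δ / 2 < -1 := by linarith
    have hg := ((integrableOn_Ioi_rpow_of_lt hexp hr0).const_mul (C * R ^ (-δ)))
    have hv : ∫ u in Ioi r, C * R ^ (-δ) * u ^ (β / 2 - 1 - δ / 2) = 2 * C / (δ - β) * R ^ (-β) := by
      rw [integral_const_mul, integral_Ioi_rpow_of_lt hexp hr0, hrp]
      have : R ^ (-β) = R ^ (-δ) * R ^ (-2 * (β / 2 - 1 - δ / 2 + 1)) := by
        rw [← Real.rpow_add hR]; congr 1; ring
      rw [this]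
      have h3 : β / 2 - 1 - δ / 2 + 1 = -((δ - β) / 2) := by ring
      rw [h3]
      field_simp
    rw [← hv, ← Real.norm_eq_abs]
    refine norm_integral_le_of_norm_le hg ((ae_restrict_iff' measurableSet_Ioi).2 (Eventually.of_forall fun u hu => ?_))
    have hu0 : 0 < u := lt_trans hr0 hu
    rw [norm_mul, Real.norm_of_nonneg (by positivity)]
    calc _ ≤ u ^ (β / 2 - 1) * (C * (u * R ^ 2) ^ (-(δ / 2))) := by
          gcongr; exact h2 u hu0
      _ = _ := by
        rw [Real.mul_rpow hu0.le (by positivity), ← Real.rpow_natCast R 2, ← Real.rpow_mul hR.le,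
          show β / 2 - 1 - δ / 2 = (β / 2 - 1) + (-(δ / 2)) by ring, Real.rpow_add hu0,
          show ((2:ℕ):ℝ) * -(δ / 2) = -δ by push_cast; ring]
        ring

lemma pot_bound (d : ℕ) (hd : 0 < d) (β C R : ℝ) (hβ : 0 < β) (hβd : β < d) (hR : 0 < R) (p : Ed d → ℝ)
    (hp : Measurable p) (hC : 0 ≤ C)
    (h1 : ∀ u, 0 < u → |∫ z, p z * Real.exp (-(u * ‖z‖ ^ 2))| ≤ 1)
    (h2 : ∀ u, 0 < u → |∫ z, p z * Real.exp (-(u * ‖z‖ ^ 2))| ≤ C * (u * R ^ 2) ^ (-((d : ℝ) / 2))) :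
    ∫ z, p z * ‖z‖ ^ (-β) ≤ (Real.Gamma (β / 2))⁻¹ * (2 / β + 2 * C / (d - β)) * R ^ (-β) := by
  have hG : 0 < Real.Gamma (β / 2) := Real.Gamma_pos_of_pos (by positivity)
  have hdβ : 0 < (d : ℝ) - β := by linarith
  have : Nonempty (Fin d) := ⟨⟨0, hd⟩⟩
  by_cases hi : Integrable (fun z => p z * ‖z‖ ^ (-β))
  swap
  · rw [integral_undef hi]; positivity
  have hrep : ∀ z : Ed d, z ≠ 0 → ∫ u in Ioi (0:ℝ), u ^ (β / 2 - 1) * Real.exp (-(u * ‖z‖ ^ 2)) = 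
      ‖z‖ ^ (-β) * Real.Gamma (β / 2) := by
    intro z hz
    have hz' : 0 < ‖z‖ := norm_pos_iff.2 hz
    have := Real.integral_rpow_mul_exp_neg_mul_Ioi (a := β / 2) (r := ‖z‖ ^ 2) (by positivity) (by positivity)
    simp_rw [mul_comm _ (‖z‖ ^ 2)]
    rw [this, one_div, Real.inv_rpow (by positivity), Real.rpow_neg (by positivity), 
      ← Real.rpow_natCast ‖z‖ 2, ← Real.rpow_mul hz'.le]
    congr 3; push_cast; ring
  have hne : ∀ᵐ z : Ed d, z ≠ 0 := by
    simp [ae_iff]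
  have e1 : ∀ᵐ z : Ed d, p z * ‖z‖ ^ (-β) = 
      (Real.Gamma (β / 2))⁻¹ * ∫ u in Ioi (0:ℝ), u ^ (β / 2 - 1) * (p z * Real.exp (-(u * ‖z‖ ^ 2))) := by
    filter_upwards [hne] with z hz
    have : ∀ u : ℝ, u ^ (β / 2 - 1) * (p z * Real.exp (-(u * ‖z‖ ^ 2))) = 
      p z * (u ^ (β / 2 - 1) * Real.exp (-(u * ‖z‖ ^ 2))) := fun u => by ring
    simp_rw [this]
    rw [integral_const_mul, hrep z hz]
    field_simp
  rw [integral_congr_ae e1, integral_const_mul, mul_assoc]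
  refine mul_le_mul_of_nonneg_left ?_ (by positivity)
  rw [integral_integral_swap]
  · simp_rw [integral_const_mul]
    exact radial_bound β d C R hβ hβd hR _ h1 h2 hC
  · have hm : Measurable (Function.uncurry fun (z : Ed d) (u : ℝ) => 
        u ^ (β / 2 - 1) * (p z * Real.exp (-(u * ‖z‖ ^ 2)))) := by
      simp only [Function.uncurry_def]; fun_prop
    rw [integrable_prod_iff hm.aestronglyMeasurable]
    constructor
    · filter_upwards [hne] with z hz
      have hz' : 0 < ‖z‖ := norm_pos_iff.2 hz
      have : ∀ u : ℝ, u ^ (β / 2 - 1) * (p z * Real.exp (-(u * ‖z‖ ^ 2))) = 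
        p z * (u ^ (β / 2 - 1) * Real.exp (-(u * ‖z‖ ^ 2))) := fun u => by ring
      simp only [Function.uncurry_def, this]
      apply Integrable.const_mul
      by_contra hcon
      have h0 := hrep z hz
      rw [integral_undef hcon] at h0
      have : 0 < ‖z‖ ^ (-β) * Real.Gamma (β / 2) := by positivity
      linarith
    · refine (hi.norm.mul_const (Real.Gamma (β / 2))).congr ?_
      filter_upwards [hne] with z hz
      simp only [Function.uncurry_def]
      have : ∀ u ∈ Ioi (0:ℝ), ‖u ^ (β / 2 - 1) * (p z * Real.exp (-(u * ‖z‖ ^ 2)))‖ = 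
        ‖p z‖ * (u ^ (β / 2 - 1) * Real.exp (-(u * ‖z‖ ^ 2))) := by
        intro u hu
        have hu0 : (0:ℝ) < u := hu
        rw [norm_mul, norm_mul, Real.norm_of_nonneg (by positivity : 0 ≤ u ^ (β / 2 - 1)), 
          Real.norm_of_nonneg (Real.exp_pos _).le]
        ring
      rw [setIntegral_congr_fun measurableSet_Ioi this, integral_const_mul, hrep z hz, norm_mul,
        Real.norm_of_nonneg (by positivity : 0 ≤ ‖z‖ ^ (-β))]
      ring

lemma main_pot (d : ℕ) (α β : ℝ) (hα : α ∈ Ioo 0 (min 2 (d : ℝ))) (hβ : β ∈ Ioo 0 (d : ℝ)) :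
    ∃ c : ℝ, 0 < c ∧ ∀ s : ℝ, 0 < s → ∀ x : Ed d, x ≠ 0 →
      ∫ z, fracKernel d α s x z * ‖z‖ ^ (-β) ≤ c * min (s ^ (-β / α)) (‖x‖ ^ (-β)) := by
  have hα0 : 0 < α := hα.1
  have hα2 : α < 2 := lt_of_lt_of_le hα.2 (min_le_left _ _)
  have hd' : (0:ℝ) < d := hα0.trans (lt_of_lt_of_le hα.2 (min_le_right _ _))
  have hd : 0 < d := by exact_mod_cast hd'
  have hpi := Real.pi_pos
  have hβ0 := hβ.1
  have hdβ : 0 < (d : ℝ) - β := by linarith [hβ.2]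
  have hG : 0 < Real.Gamma (β / 2) := Real.Gamma_pos_of_pos (by positivity)
  set C1 : ℝ := ((d : ℝ) / 2) ^ ((d : ℝ) / 2)
  set C2 : ℝ := (1 / (4 * π)) ^ ((d : ℝ) / 2) * ∫ ξ : Ed d, Real.exp (-(‖ξ‖ ^ α))
  have hC1 : 0 ≤ C1 := by positivity
  have hC2 : 0 ≤ C2 := mul_nonneg (by positivity) (integral_nonneg fun ξ => (Real.exp_pos _).le)
  set K1 := (Real.Gamma (β / 2))⁻¹ * (2 / β + 2 * C1 / (d - β))
  set K2 := (Real.Gamma (β / 2))⁻¹ * (2 / β + 2 * C2 / (d - β))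
  have hK1 : 0 < K1 := by positivity
  refine ⟨max K1 K2, lt_max_of_lt_left hK1, fun s hs x hx => ?_⟩
  have hx' : 0 < ‖x‖ := norm_pos_iff.2 hx
  rw [mul_min_of_nonneg _ _ (hK1.le.trans (le_max_left _ _))]
  apply le_min
  · have h := pot_bound d hd β C2 (s ^ (1 / α)) hβ.1 hβ.2 (by positivity) (fracKernel d α s x) 
      (frac_meas d α x s) hC2
      (fun u hu => by rw [frac_gauss d hd α hα0 u hu x s hs]; exact A_bound_one d α u hu x s hs)
      (fun u hu => by rw [frac_gauss d hd α hα0 u hu x s hs]; exact A_bound_s d hd α hα0 u hu x s hs)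
    rw [← Real.rpow_mul hs.le, show 1 / α * -β = -β / α by ring] at h
    refine h.trans ?_
    gcongr
    exact le_max_right _ _
  · have h := pot_bound d hd β C1 ‖x‖ hβ.1 hβ.2 hx' (fracKernel d α s x) 
      (frac_meas d α x s) hC1
      (fun u hu => by rw [frac_gauss d hd α hα0 u hu x s hs]; exact A_bound_one d α u hu x s hs)
      (fun u hu => by rw [frac_gauss d hd α hα0 u hu x s hs]; exact A_bound_x d hd α ⟨hα0, hα2⟩ u hu x hx s hs)
    refine h.trans ?_
    gcongr
    exact le_max_left _ _

lemma outer_mono (t : ℝ) (F g : ℝ → ℝ) (h : ∀ s ∈ Ioo 0 t, F s ≤ g s) (h0 : ∀ s ∈ Ioo 0 t, 0 ≤ g s)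
    (hg : IntegrableOn g (Ioo 0 t)) : ∫ s in Ioo 0 t, F s ≤ ∫ s in Ioo 0 t, g s := by
  by_cases hF : IntegrableOn F (Ioo 0 t)
  · exact setIntegral_mono_on hF hg measurableSet_Ioo h
  · rw [integral_undef hF]; exact setIntegral_nonneg measurableSet_Ioo h0

lemma outer_rpow (t r : ℝ) (ht : 0 < t) (hr : 0 < r) : 
    IntegrableOn (fun s : ℝ => s ^ (r - 1)) (Ioo 0 t) ∧ ∫ s in Ioo 0 t, s ^ (r - 1) = t ^ r / r := by
  have hint : IntervalIntegrable (fun u : ℝ => u ^ (r - 1)) volume 0 t :=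
      intervalIntegral.intervalIntegrable_rpow' (by linarith)
  constructor
  · exact (intervalIntegrable_iff_integrableOn_Ioo_of_le ht.le).1 hint
  · rw [← integral_Ioc_eq_integral_Ioo, ← intervalIntegral.integral_of_le ht.le, 
      integral_rpow (Or.inl (by linarith)), sub_add_cancel, Real.zero_rpow hr.ne', sub_zero]

lemma outer_log (t r b : ℝ) (ht : 0 < t) (hr : 0 < r) (hb : 0 < b) :
    IntegrableOn (fun s : ℝ => b * r * s ^ (r - 1) / (1 + b * s ^ r)) (Ioo 0 t) ∧
    ∫ s in Ioo 0 t, b * r * s ^ (r - 1) / (1 + b * s ^ r) = Real.log (1 + b * t ^ r) := by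
  have hc : ContinuousOn (fun s : ℝ => Real.log (1 + b * s ^ r)) (Icc 0 t) := by
    apply ContinuousOn.log
    · exact (continuous_const.add (continuous_const.mul (Real.continuous_rpow_const hr.le))).continuousOn
    · intro s hs
      have : 0 ≤ s := hs.1
      positivity
  have hder : ∀ s ∈ Ioo 0 t, HasDerivAt (fun s : ℝ => Real.log (1 + b * s ^ r)) 
      (b * r * s ^ (r - 1) / (1 + b * s ^ r)) s := by
    intro s hs
    have hs0 : 0 < s := hs.1
    have h1 := ((Real.hasDerivAt_rpow_const (x := s) (p := r) (Or.inl hs0.ne')).const_mul b).const_add 1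
    convert h1.log (by positivity) using 1
    ring
  have hpos : ∀ s ∈ Ioo 0 t, 0 ≤ b * r * s ^ (r - 1) / (1 + b * s ^ r) := by
    intro s hs
    have hs0 : 0 < s := hs.1
    positivity
  have hint := intervalIntegral.integrableOn_deriv_of_nonneg hc hder hpos
  refine ⟨hint.mono_set Ioo_subset_Ioc_self, ?_⟩
  rw [← integral_Ioc_eq_integral_Ioo, ← intervalIntegral.integral_of_le ht.le, 
    intervalIntegral.integral_eq_sub_of_hasDerivAt_of_le ht.le hc hder 
      ((intervalIntegrable_iff_integrableOn_Ioc_of_le ht.le).2 hint)]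
  have hr1 : r ≠ 0 := ne_of_gt hr
  simp [Real.zero_rpow hr1]

/-- Integral estimates for the fractional heat kernel against `s^{γ/α}|z|^{-β}` (Lemma 3.1). -/
theorem stmt_13 (d : ℕ) (α β γ : ℝ) (hα : α ∈ Ioo 0 (min 2 (d : ℝ)))
    (hβ : β ∈ Ioo 0 (d : ℝ)) (hγ : β - α ≤ γ) :
    ∃ c : ℝ, 0 < c ∧ ∀ t : ℝ, 0 < t → ∀ x : Ed d, x ≠ 0 →
      (β - α < γ →
        (∫ s in Ioo (0 : ℝ) t, ∫ z : Ed d,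
            s ^ (γ / α) * fracKernel d α s x z * ‖z‖ ^ (-β)) ≤
          c * t ^ ((γ + α) / α) * min (t ^ (-β / α)) (‖x‖ ^ (-β))) ∧
      (γ = β - α →
        (∫ s in Ioo (0 : ℝ) t, ∫ z : Ed d,
            s ^ (γ / α) * fracKernel d α s x z * ‖z‖ ^ (-β)) ≤
          c * Real.log (1 + t ^ (β / α) * ‖x‖ ^ (-β))) := by
  obtain ⟨C, hC, hpot⟩ := main_pot d α β hα hβ
  have hα0 : 0 < α := hα.1
  have hβ0 : 0 < β := hβ.1
  have hinner : ∀ s : ℝ, 0 < s → ∀ x : Ed d, x ≠ 0 →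
      (∫ z : Ed d, s ^ (γ / α) * fracKernel d α s x z * ‖z‖ ^ (-β)) ≤
        C * (s ^ (γ / α) * min (s ^ (-β / α)) (‖x‖ ^ (-β))) := by
    intro s hs x hx
    simp_rw [mul_assoc]
    rw [integral_const_mul]
    calc _ ≤ s ^ (γ / α) * (C * min (s ^ (-β / α)) (‖x‖ ^ (-β))) := by
          gcongr
          exact hpot s hs x hx
      _ = _ := by ring
  rcases hγ.eq_or_lt with hEq | hLt
  · -- critical case
    refine ⟨C * (2 * (α / β)), by positivity, fun t ht x hx => ⟨fun h => absurd h (by linarith), fun _ => ?_⟩⟩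
    have hx' : 0 < ‖x‖ := norm_pos_iff.2 hx
    set b := ‖x‖ ^ (-β) with hb
    have hb0 : 0 < b := by positivity
    set r := β / α with hr
    have hr0 : 0 < r := by positivity
    obtain ⟨hi, hv⟩ := outer_log t r b ht hr0 hb0
    have hgr : γ / α = r - 1 := by rw [← hEq, hr]; field_simp
    have hnr : -β / α = -r := by rw [hr]; ring
    rw [mul_comm (t ^ r) b, ← hv, ← integral_const_mul]
    refine outer_mono t _ _ (fun s hs => ?_) (fun s hs => ?_) (hi.const_mul _)
    · have hs0 : 0 < s := hs.1
      refine (hinner s hs0 x hx).trans ?_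
      rw [hgr, hnr, mul_assoc C]
      refine mul_le_mul_of_nonneg_left ?_ hC.le
      have hy : 0 < s ^ r := by positivity
      have hm : min (s ^ (-r)) b ≤ 2 * b / (1 + b * s ^ r) := by
        rw [Real.rpow_neg hs0.le, le_div_iff₀ (by positivity)]
        rcases le_total (b * s ^ r) 1 with h | h
        · calc _ ≤ b * (1 + b * s ^ r) := by gcongr; exact min_le_right _ _
            _ ≤ _ := by nlinarith
        · calc _ ≤ (s ^ r)⁻¹ * (1 + b * s ^ r) := by gcongr; exact min_le_left _ _
            _ = (s ^ r)⁻¹ + b := by field_simp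
            _ ≤ 2 * b := by
              have : (s ^ r)⁻¹ ≤ b := by rw [inv_le_iff_one_le_mul₀ hy]; exact h
              linarith
      calc _ ≤ s ^ (r - 1) * (2 * b / (1 + b * s ^ r)) := by gcongr
        _ = _ := by
          have : α / β * r = 1 := by rw [hr]; field_simp
          calc _ = (α / β * r) * (s ^ (r - 1) * (2 * b / (1 + b * s ^ r))) := by rw [this, one_mul]
            _ = _ := by ring
    · have hs0 : 0 < s := hs.1
      positivity
  · have hpos1 : 0 < (γ - β + α) / α := div_pos (by linarith) hα0
    have hpos2 : 0 < (γ + α) / α := div_pos (by linarith) hα0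
    set k1 := (γ - β + α) / α with hk1
    set k2 := (γ + α) / α with hk2
    have hk12 : k1 ≤ k2 := by rw [hk1, hk2]; gcongr; linarith
    refine ⟨C / k1, by positivity, fun t ht x hx => ⟨fun _ => ?_, fun h => absurd h (by linarith)⟩⟩
    have hx' : 0 < ‖x‖ := norm_pos_iff.2 hx
    rw [mul_min_of_nonneg _ _ (by positivity)]
    apply le_min
    · obtain ⟨hi, hv⟩ := outer_rpow t k1 ht hpos1
      have : C / k1 * t ^ k2 * t ^ (-β / α) = ∫ s in Ioo 0 t, C * s ^ (k1 - 1) := by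
        rw [integral_const_mul, hv, mul_assoc, ← Real.rpow_add ht, 
          show k2 + -β / α = k1 by rw [hk1, hk2]; ring]
        ring
      rw [this]
      refine outer_mono t _ _ (fun s hs => ?_) (fun s hs => ?_) (hi.const_mul _)
      · have hs0 : 0 < s := hs.1
        refine (hinner s hs0 x hx).trans ?_
        have : s ^ (k1 - 1) = s ^ (γ / α) * s ^ (-β / α) := by
          rw [← Real.rpow_add hs0]; congr 1; rw [hk1]; field_simp; ring
        rw [this]
        gcongr
        exact min_le_left _ _
      · have hs0 : 0 < s := hs.1
        positivity
    · obtain ⟨hi, hv⟩ := outer_rpow t k2 ht hpos2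
      have h1 : ∫ s in Ioo 0 t, C * ‖x‖ ^ (-β) * s ^ (k2 - 1) ≤ C / k1 * t ^ k2 * ‖x‖ ^ (-β) := by
        rw [integral_const_mul, hv]
        calc _ = C / k2 * t ^ k2 * ‖x‖ ^ (-β) := by ring
          _ ≤ _ := by gcongr
      refine le_trans ?_ h1
      refine outer_mono t _ _ (fun s hs => ?_) (fun s hs => ?_) (hi.const_mul _)
      · have hs0 : 0 < s := hs.1
        refine (hinner s hs0 x hx).trans ?_
        have : k2 - 1 = γ / α := by rw [hk2]; field_simp; ring
        rw [this, mul_assoc, mul_comm (‖x‖ ^ (-β))]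
        gcongr
        exact min_le_right _ _
      · have hs0 : 0 < s := hs.1
        positivity
end
end
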